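/- Let Γ_t, t ∈ [0, T), be a smooth solution of the Yang–Mills flow on the trivial bundle ℝⁿ × ℝᵐ with metric-compatible values, such that for every compact subinterval J ⊆ [0, T) there is a polynomial p with |F_t(x)| + Σ_{i,j,k} ‖∇ᵢ(F_t)_{jk}(x)‖ + Σ_{i,j,k,l} ‖∇ᵢ∇ⱼ(F_t)_{kl}(x)‖ ≤ p(|x|) for all t ∈ J and x ∈ ℝⁿ. Then the entropy is nonincreasing along the flow: λ(Γ_{t₂}) ≤ λ(Γ_{t₁}) (as values in [0, ∞]) whenever 0 ≤ t₁ ≤ t₂ < T. -/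

import Mathlib

open MeasureTheory Real Filter Matrix
open scoped ENNReal

noncomputable section

namespace YM

variable {n m : ℕ}

/-- A connection on the trivial bundle `ℝⁿ × ℝᵐ`, given by its coefficient
matrices `Γ₁(x), …, Γₙ(x)`. -/
abbrev Conn (n m : ℕ) :=
  (Fin n → ℝ) → Fin n → Matrix (Fin m) (Fin m) ℝ

/-- Entrywise `i`-th partial derivative of a matrix-valued map on `ℝⁿ`. -/
def pder (i : Fin n) (A : (Fin n → ℝ) → Matrix (Fin m) (Fin m) ℝ)
    (x : Fin n → ℝ) : Matrix (Fin m) (Fin m) ℝ :=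
  Matrix.of fun a b => fderiv ℝ (fun y => A y a b) x (Pi.single i 1)

/-- Smoothness (entrywise) of a matrix-valued map on `ℝⁿ`. -/
def SmoothMat (A : (Fin n → ℝ) → Matrix (Fin m) (Fin m) ℝ) : Prop :=
  ∀ a b, ContDiff ℝ (⊤ : ℕ∞) fun y => A y a b

/-- Smoothness of a connection. -/
def Smooth (Γ : Conn n m) : Prop :=
  ∀ i, SmoothMat fun x => Γ x i

/-- Matrix commutator. -/
def comm (A B : Matrix (Fin m) (Fin m) ℝ) : Matrix (Fin m) (Fin m) ℝ :=
  A * B - B * A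

/-- Curvature `F_{ij} = ∂ᵢΓⱼ − ∂ⱼΓᵢ + [Γᵢ, Γⱼ]`. -/
def curv (Γ : Conn n m) (i j : Fin n) (x : Fin n → ℝ) :
    Matrix (Fin m) (Fin m) ℝ :=
  pder i (fun y => Γ y j) x - pder j (fun y => Γ y i) x + comm (Γ x i) (Γ x j)

/-- Covariant derivative `∇ᵢA = ∂ᵢA + [Γᵢ, A]`. -/
def covDer (Γ : Conn n m) (i : Fin n)
    (A : (Fin n → ℝ) → Matrix (Fin m) (Fin m) ℝ) (x : Fin n → ℝ) :
    Matrix (Fin m) (Fin m) ℝ :=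
  pder i A x + comm (Γ x i) (A x)

/-- `(D*F)ₖ = −Σᵢ ∇ᵢF_{ik}`. -/
def dstarF (Γ : Conn n m) (k : Fin n) (x : Fin n → ℝ) :
    Matrix (Fin m) (Fin m) ℝ :=
  - ∑ i, covDer Γ i (fun y => curv Γ i k y) x

/-- Squared Frobenius norm of a matrix. -/
def frobSq (A : Matrix (Fin m) (Fin m) ℝ) : ℝ := ∑ a, ∑ b, (A a b) ^ 2

/-- Frobenius norm of a matrix. -/
def frobNorm (A : Matrix (Fin m) (Fin m) ℝ) : ℝ := Real.sqrt (frobSq A)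

/-- Frobenius inner product `⟨A, B⟩ = tr(A Bᵀ)`. -/
def frobInner (A B : Matrix (Fin m) (Fin m) ℝ) : ℝ := ∑ a, ∑ b, A a b * B a b

/-- `|F(x)|² = Σ_{i,j} ‖F_{ij}(x)‖²` (Frobenius norms). -/
def normSqF (Γ : Conn n m) (x : Fin n → ℝ) : ℝ :=
  ∑ i, ∑ j, frobSq (curv Γ i j x)

/-- `|F(x)|`. -/
def normF (Γ : Conn n m) (x : Fin n → ℝ) : ℝ := Real.sqrt (normSqF Γ x)

/-- Euclidean norm on `ℝⁿ`. -/
def enorm (x : Fin n → ℝ) : ℝ := Real.sqrt (∑ i, x i ^ 2)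

/-- Metric compatibility: all coefficient matrices are skew-symmetric. -/
def MetricCompat (Γ : Conn n m) : Prop :=
  ∀ x i, (Γ x i)ᵀ = -(Γ x i)

/-- `(x₀,t₀)`-soliton: `Σᵢ ∇ᵢF_{ik} = (1/(2t₀)) Σᵢ (x−x₀)ᵢ F_{ik}`. -/
def IsSolitonAt (Γ : Conn n m) (x₀ : Fin n → ℝ) (t₀ : ℝ) : Prop :=
  ∀ (x : Fin n → ℝ) (k : Fin n),
    ∑ i, covDer Γ i (fun y => curv Γ i k y) x
      = (1 / (2 * t₀)) • ∑ i, (x i - x₀ i) • curv Γ i k x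

/-- `(0,1)`-soliton. -/
def IsSoliton (Γ : Conn n m) : Prop := IsSolitonAt Γ 0 1

/-- The `ℱ`-functional
`ℱ_{x₀,t₀}(Γ) = t₀² (4πt₀)^{−n/2} ∫ |F|² e^{−|x−x₀|²/(4t₀)}`. -/
def Ffunc (Γ : Conn n m) (x₀ : Fin n → ℝ) (t₀ : ℝ) : ℝ :=
  t₀ ^ 2 * (4 * π * t₀) ^ (-(n : ℝ) / 2) *
    ∫ x : Fin n → ℝ,
      normSqF Γ x * Real.exp (-(∑ i, (x i - x₀ i) ^ 2) / (4 * t₀))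

/-- The entropy `λ(Γ) = sup_{x₀, t₀>0} ℱ_{x₀,t₀}(Γ)`, valued in `[0,∞]`. -/
def entropy (Γ : Conn n m) : ℝ≥0∞ :=
  ⨆ (x₀ : Fin n → ℝ) (t₀ : ℝ) (_ : 0 < t₀), ENNReal.ofReal (Ffunc Γ x₀ t₀)

/-- Polynomial curvature growth: `|F(x)| ≤ p(|x|)`. -/
def PolyCurvGrowth (Γ : Conn n m) : Prop :=
  ∃ p : Polynomial ℝ, ∀ x, normF Γ x ≤ p.eval (enorm x)

/-- Polynomial curvature growth to order two. -/
def PolyCurvGrowth2 (Γ : Conn n m) : Prop :=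
  ∃ p : Polynomial ℝ, ∀ x,
    normF Γ x
      + (∑ i, ∑ j, ∑ k, frobNorm (covDer Γ i (fun y => curv Γ j k y) x))
      + (∑ i, ∑ j, ∑ k, ∑ l,
          frobNorm (covDer Γ i
            (fun y => covDer Γ j (fun z => curv Γ k l z) y) x))
      ≤ p.eval (enorm x)

/-- Cylindrical: some nonzero constant vector `V` satisfies `V ⌟ F ≡ 0`. -/
def Cylindrical (Γ : Conn n m) : Prop :=
  ∃ V : Fin n → ℝ, V ≠ 0 ∧
    ∀ (x : Fin n → ℝ) (k : Fin n), ∑ i, V i • curv Γ i k x = 0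

/-- `(DB)_{ij} = ∇ᵢBⱼ − ∇ⱼBᵢ`. -/
def Dop (Γ B : Conn n m) (i j : Fin n) (x : Fin n → ℝ) :
    Matrix (Fin m) (Fin m) ℝ :=
  covDer Γ i (fun y => B y j) x - covDer Γ j (fun y => B y i) x

/-- The second variation operator
`(L_{x₀,t₀}B)ₖ = −Σᵢ∇ᵢ(DB)_{ik} + (1/(2t₀))Σᵢ(x−x₀)ᵢ(DB)_{ik} + Σᵢ[Bᵢ,F_{ik}]`. -/
def Lop (Γ B : Conn n m) (x₀ : Fin n → ℝ) (t₀ : ℝ) (k : Fin n)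
    (x : Fin n → ℝ) : Matrix (Fin m) (Fin m) ℝ :=
  (- ∑ i, covDer Γ i (fun y => Dop Γ B i k y) x)
    + (1 / (2 * t₀)) • ∑ i, (x i - x₀ i) • Dop Γ B i k x
    + ∑ i, comm (B x i) (curv Γ i k x)

/-- The Gaussian weight `G(x) = (4π)^{−n/2} e^{−|x|²/4}`. -/
def gaussG (n : ℕ) (x : Fin n → ℝ) : ℝ :=
  (4 * π) ^ (-(n : ℝ) / 2) * Real.exp (-(∑ i, x i ^ 2) / 4)

/-- The second variation form `Q(σ,V,B)` of a `(0,1)`-soliton. -/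
def Q (Γ : Conn n m) (σ : ℝ) (V : Fin n → ℝ) (B : Conn n m) : ℝ :=
  -4 * σ ^ 2 * (∫ x : Fin n → ℝ, (∑ k, frobSq (dstarF Γ k x)) * gaussG n x)
    - 2 * (∫ x : Fin n → ℝ,
        (∑ k, frobSq (∑ i, V i • curv Γ i k x)) * gaussG n x)
    + 4 * (∫ x : Fin n → ℝ,
        (∑ k, frobInner (B x k) (Lop Γ B 0 1 k x)) * gaussG n x)
    - 4 * (∫ x : Fin n → ℝ,
        (∑ k, frobInner (B x k)
          (∑ i, (σ * x i + V i) • curv Γ i k x)) * gaussG n x)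

/-- Skew-symmetric-matrix-valued 1-form. -/
def SkewVals (B : Conn n m) : Prop := ∀ x i, (B x i)ᵀ = -(B x i)

/-- `ℱ`-instability. -/
def FUnstable (Γ : Conn n m) : Prop :=
  ∃ B : Conn n m, Smooth B ∧ HasCompactSupport B ∧ SkewVals B ∧
    ∀ (σ : ℝ) (V : Fin n → ℝ), Q Γ σ V B < 0

/-- Joint smoothness (entrywise) of a one-parameter family of connections on a
time set `S`. -/
def SmoothFamilyOn (Γt : ℝ → Conn n m) (S : Set ℝ) : Prop :=
  ∀ (k : Fin n) (a b : Fin m),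
    ContDiffOn ℝ (⊤ : ℕ∞) (fun p : ℝ × (Fin n → ℝ) => Γt p.1 p.2 k a b)
      (S ×ˢ (Set.univ : Set (Fin n → ℝ)))

/-- Yang–Mills flow: `∂ₜ(Γ_t)ₖ = Σᵢ ∇ᵢ(F_t)_{ik}` on a time set `S`. -/
def YMFlowOn (Γt : ℝ → Conn n m) (S : Set ℝ) : Prop :=
  ∀ t ∈ S, ∀ (x : Fin n → ℝ) (k : Fin n) (a b : Fin m),
    HasDerivWithinAt (fun t' => Γt t' x k a b)
      ((∑ i, covDer (Γt t) i (fun y => curv (Γt t) i k y) x) a b) S t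

/-- Locally uniform in time polynomial curvature growth to order two. -/
def PolyCurvGrowth2On (Γt : ℝ → Conn n m) (S : Set ℝ) : Prop :=
  ∀ J : Set ℝ, IsCompact J → J ⊆ S →
    ∃ p : Polynomial ℝ, ∀ t ∈ J, ∀ x,
      normF (Γt t) x
        + (∑ i, ∑ j, ∑ k,
            frobNorm (covDer (Γt t) i (fun y => curv (Γt t) j k y) x))
        + (∑ i, ∑ j, ∑ k, ∑ l,
            frobNorm (covDer (Γt t) i
              (fun y => covDer (Γt t) j (fun z => curv (Γt t) k l z) y) x))
        ≤ p.eval (enorm x)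

end YM

namespace YM

variable {n m : ℕ}


/-- Line derivative in the `i`-th coordinate direction. -/
def HD (i : Fin n) (f : (Fin n → ℝ) → ℝ) (f' : ℝ) (x : Fin n → ℝ) : Prop :=
  HasDerivAt (fun t : ℝ => f (x + t • Pi.single i 1)) f' 0

lemma HD.mul {i : Fin n} {f g : (Fin n → ℝ) → ℝ} {f' g' : ℝ} {x : Fin n → ℝ}
    (hf : HD i f f' x) (hg : HD i g g' x) :
    HD i (fun y => f y * g y) (f' * g x + f x * g') x := by
  have := HasDerivAt.mul hf hg
  simp only [zero_smul, add_zero] at this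
  exact this

lemma HD.add {i : Fin n} {f g : (Fin n → ℝ) → ℝ} {f' g' : ℝ} {x : Fin n → ℝ}
    (hf : HD i f f' x) (hg : HD i g g' x) :
    HD i (fun y => f y + g y) (f' + g') x := HasDerivAt.add hf hg

lemma HD.sub {i : Fin n} {f g : (Fin n → ℝ) → ℝ} {f' g' : ℝ} {x : Fin n → ℝ}
    (hf : HD i f f' x) (hg : HD i g g' x) :
    HD i (fun y => f y - g y) (f' - g') x := HasDerivAt.sub hf hg

lemma HD.sum {ι : Type*} {s : Finset ι} {i : Fin n} {f : ι → (Fin n → ℝ) → ℝ} {f' : ι → ℝ}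
    {x : Fin n → ℝ} (hf : ∀ k ∈ s, HD i (f k) (f' k) x) :
    HD i (fun y => ∑ k ∈ s, f k y) (∑ k ∈ s, f' k) x := HasDerivAt.fun_sum hf

lemma HD.const_mul {i : Fin n} {f : (Fin n → ℝ) → ℝ} {f' : ℝ} {x : Fin n → ℝ} (c : ℝ)
    (hf : HD i f f' x) : HD i (fun y => c * f y) (c * f') x := HasDerivAt.const_mul c hf

lemma HD.coord (i k : Fin n) (c : ℝ) (x : Fin n → ℝ) :
    HD i (fun y => y k - c) (if i = k then 1 else 0) x := by
  unfold HD
  have h : HasDerivAt (fun t : ℝ => x k + t * (Pi.single i 1 : Fin n → ℝ) k - c)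
      (1 * (Pi.single i 1 : Fin n → ℝ) k) 0 :=
    (((hasDerivAt_id (0:ℝ)).mul_const _).const_add _).sub_const _
  have e : (Pi.single i 1 : Fin n → ℝ) k = if i = k then 1 else 0 := by
    rw [Pi.single_apply]; simp [eq_comm]
  rw [e, one_mul] at h
  simpa [Pi.single_apply, eq_comm] using h

lemma HD.of_diff {i : Fin n} {f : (Fin n → ℝ) → ℝ} {x : Fin n → ℝ}
    (hf : DifferentiableAt ℝ f x) : HD i f (fderiv ℝ f x (Pi.single i 1)) x :=
  hf.hasFDerivAt.hasLineDerivAt _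

lemma HD.unique {i : Fin n} {f : (Fin n → ℝ) → ℝ} {f' g' : ℝ} {x : Fin n → ℝ}
    (hf : HD i f f' x) (hg : HD i f g' x) : f' = g' := HasDerivAt.unique hf hg

lemma SmoothMat.hd {A : (Fin n → ℝ) → Matrix (Fin m) (Fin m) ℝ} (hA : SmoothMat A)
    (i : Fin n) (a b : Fin m) (x : Fin n → ℝ) :
    HD i (fun y => A y a b) (pder i A x a b) x :=
  HD.of_diff ((hA a b).differentiable (by simp) x)

lemma SmoothMat.pder {A : (Fin n → ℝ) → Matrix (Fin m) (Fin m) ℝ} (hA : SmoothMat A)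
    (i : Fin n) : SmoothMat (pder i A) := by
  intro a b
  have h : ContDiff ℝ (⊤ : ℕ∞) (fderiv ℝ fun y => A y a b) :=
    (hA a b).fderiv_right (by simp)
  exact h.clm_apply contDiff_const

lemma SmoothMat.add {A B : (Fin n → ℝ) → Matrix (Fin m) (Fin m) ℝ} (hA : SmoothMat A)
    (hB : SmoothMat B) : SmoothMat (fun x => A x + B x) := fun a b => (hA a b).add (hB a b)

lemma SmoothMat.sub {A B : (Fin n → ℝ) → Matrix (Fin m) (Fin m) ℝ} (hA : SmoothMat A)
    (hB : SmoothMat B) : SmoothMat (fun x => A x - B x) := fun a b => (hA a b).sub (hB a b)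

lemma SmoothMat.mul {A B : (Fin n → ℝ) → Matrix (Fin m) (Fin m) ℝ} (hA : SmoothMat A)
    (hB : SmoothMat B) : SmoothMat (fun x => A x * B x) := by
  intro a b
  simp only [Matrix.mul_apply]
  exact ContDiff.sum fun c _ => (hA a c).mul (hB c b)

lemma SmoothMat.comm {A B : (Fin n → ℝ) → Matrix (Fin m) (Fin m) ℝ} (hA : SmoothMat A)
    (hB : SmoothMat B) : SmoothMat (fun x => comm (A x) (B x)) := (hA.mul hB).sub (hB.mul hA)

lemma SmoothMat.sum {ι : Type*} {s : Finset ι} {A : ι → (Fin n → ℝ) → Matrix (Fin m) (Fin m) ℝ}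
    (hA : ∀ k, SmoothMat (A k)) : SmoothMat (fun x => ∑ k ∈ s, A k x) := by
  intro a b
  simp only [Matrix.sum_apply]
  exact ContDiff.sum fun c _ => hA c a b

lemma SmoothMat.covDer {Γ : Conn n m} (hΓ : Smooth Γ)
    {A : (Fin n → ℝ) → Matrix (Fin m) (Fin m) ℝ} (hA : SmoothMat A)
    (i : Fin n) : SmoothMat (covDer Γ i A) := (hA.pder i).add ((hΓ i).comm hA)

lemma Smooth.curv {Γ : Conn n m} (hΓ : Smooth Γ) (i j : Fin n) : SmoothMat (curv Γ i j) :=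
  (((hΓ j).pder i).sub ((hΓ i).pder j)).add ((hΓ i).comm (hΓ j))

lemma pder_eq_of_hd {A : (Fin n → ℝ) → Matrix (Fin m) (Fin m) ℝ} (hA : SmoothMat A)
    {i : Fin n} {x : Fin n → ℝ} {M : Matrix (Fin m) (Fin m) ℝ}
    (h : ∀ a b, HD i (fun y => A y a b) (M a b) x) : pder i A x = M := by
  ext a b
  exact (hA.hd i a b x).unique (h a b)

lemma pder_add {A B : (Fin n → ℝ) → Matrix (Fin m) (Fin m) ℝ} (hA : SmoothMat A)
    (hB : SmoothMat B) (i : Fin n) (x : Fin n → ℝ) :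
    pder i (fun y => A y + B y) x = pder i A x + pder i B x :=
  pder_eq_of_hd (hA.add hB) fun a b => (hA.hd i a b x).add (hB.hd i a b x)

lemma pder_sub {A B : (Fin n → ℝ) → Matrix (Fin m) (Fin m) ℝ} (hA : SmoothMat A)
    (hB : SmoothMat B) (i : Fin n) (x : Fin n → ℝ) :
    pder i (fun y => A y - B y) x = pder i A x - pder i B x :=
  pder_eq_of_hd (hA.sub hB) fun a b => (hA.hd i a b x).sub (hB.hd i a b x)

lemma pder_sum {ι : Type*} {s : Finset ι} {A : ι → (Fin n → ℝ) → Matrix (Fin m) (Fin m) ℝ}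
    (hA : ∀ k, SmoothMat (A k)) (i : Fin n) (x : Fin n → ℝ) :
    pder i (fun y => ∑ k ∈ s, A k y) x = ∑ k ∈ s, pder i (A k) x :=
  pder_eq_of_hd (SmoothMat.sum hA) fun a b => by
    simp only [Matrix.sum_apply]
    exact HD.sum fun k _ => (hA k).hd i a b x

lemma pder_mul {A B : (Fin n → ℝ) → Matrix (Fin m) (Fin m) ℝ} (hA : SmoothMat A)
    (hB : SmoothMat B) (i : Fin n) (x : Fin n → ℝ) :
    pder i (fun y => A y * B y) x = pder i A x * B x + A x * pder i B x :=
  pder_eq_of_hd (hA.mul hB) fun a b => by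
    simp only [Matrix.mul_apply, Matrix.add_apply, ← Finset.sum_add_distrib]
    exact HD.sum fun k _ => (hA.hd i a k x).mul (hB.hd i k b x)

lemma pder_comm {A B : (Fin n → ℝ) → Matrix (Fin m) (Fin m) ℝ} (hA : SmoothMat A)
    (hB : SmoothMat B) (i : Fin n) (x : Fin n → ℝ) :
    pder i (fun y => comm (A y) (B y)) x = comm (pder i A x) (B x) + comm (A x) (pder i B x) := by
  unfold comm
  rw [pder_sub (hA.mul hB) (hB.mul hA), pder_mul hA hB, pder_mul hB hA]
  abel

lemma pder_pder_symm {A : (Fin n → ℝ) → Matrix (Fin m) (Fin m) ℝ} (hA : SmoothMat A)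
    (i j : Fin n) (x : Fin n → ℝ) : pder i (pder j A) x = pder j (pder i A) x := by
  have key : ∀ i j a b, pder i (pder j A) x a b =
      fderiv ℝ (fderiv ℝ fun y => A y a b) x (Pi.single i 1) (Pi.single j 1) := by
    intro i j a b
    have h : ContDiff ℝ (⊤ : ℕ∞) (fderiv ℝ fun y => A y a b) :=
      (hA a b).fderiv_right (by simp)
    have h2 := (h.differentiable (by simp) x).hasFDerivAt.clm_apply
      (hasFDerivAt_const (Pi.single j (1:ℝ) : Fin n → ℝ) x)
    have h3 := h2.fderiv
    simp only [YM.pder, Matrix.of_apply]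
    rw [h3]; simp
  ext a b
  rw [key, key]
  have hs : IsSymmSndFDerivAt ℝ (fun y => A y a b) x :=
    (hA a b).contDiffAt.isSymmSndFDerivAt (by
      rw [minSmoothness_of_isRCLikeNormedField]; exact WithTop.coe_le_coe.2 (le_top : (2 : ℕ∞) ≤ ⊤))
  exact hs _ _

lemma curv_antisymm (Γ : Conn n m) (i j : Fin n) (x : Fin n → ℝ) :
    curv Γ i j x = - curv Γ j i x := by
  unfold curv comm; abel

lemma bianchi {Γ : Conn n m} (hΓ : Smooth Γ) (i j k : Fin n) (x : Fin n → ℝ) :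
    covDer Γ i (curv Γ j k) x + covDer Γ j (curv Γ k i) x + covDer Γ k (curv Γ i j) x = 0 := by
  have e : ∀ i j k, pder i (curv Γ j k) x = pder i (pder j fun y => Γ y k) x
      - pder i (pder k fun y => Γ y j) x + (comm (pder i (fun y => Γ y j) x) (Γ x k)
        + comm (Γ x j) (pder i (fun y => Γ y k) x)) := by
    intro i j k
    have := pder_add (((hΓ k).pder j).sub ((hΓ j).pder k)) ((hΓ j).comm (hΓ k)) i x
    rw [pder_sub ((hΓ k).pder j) ((hΓ j).pder k), pder_comm (hΓ j) (hΓ k)] at this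
    exact this
  simp only [covDer, e]
  rw [pder_pder_symm (hΓ k) j i, pder_pder_symm (hΓ j) i k, pder_pder_symm (hΓ i) k j]
  simp only [curv, comm]
  noncomm_ring

lemma frobInner_comm_skew {G A B : Matrix (Fin m) (Fin m) ℝ} (hG : Gᵀ = -G) :
    frobInner (comm G A) B + frobInner A (comm G B) = 0 := by
  have hI : ∀ A B : Matrix (Fin m) (Fin m) ℝ, frobInner A B = (A * Bᵀ).trace := by
    intro A B; simp [frobInner, Matrix.trace, Matrix.mul_apply]
  rw [hI, hI]; unfold comm
  simp only [Matrix.transpose_sub, Matrix.transpose_mul, hG, Matrix.sub_mul, Matrix.mul_sub,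
    Matrix.trace_sub, Matrix.mul_neg, Matrix.neg_mul, Matrix.trace_neg]
  have h1 : (G * A * Bᵀ).trace = (A * (Bᵀ * G)).trace := by
    rw [Matrix.mul_assoc, Matrix.trace_mul_comm, Matrix.mul_assoc]
  rw [h1, Matrix.mul_assoc A G]; ring

lemma hd_frobInner {Γ : Conn n m} (hc : MetricCompat Γ)
    {A B : (Fin n → ℝ) → Matrix (Fin m) (Fin m) ℝ} (hA : SmoothMat A)
    (hB : SmoothMat B) (i : Fin n) (x : Fin n → ℝ) :
    HD i (fun y => frobInner (A y) (B y))
      (frobInner (covDer Γ i A x) (B x) + frobInner (A x) (covDer Γ i B x)) x := by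
  have h1 : HD i (fun y => frobInner (A y) (B y))
      (frobInner (pder i A x) (B x) + frobInner (A x) (pder i B x)) x := by
    simp only [frobInner, ← Finset.sum_add_distrib]
    exact HD.sum fun a _ => HD.sum fun b _ => (hA.hd i a b x).mul (hB.hd i a b x)
  have h2 := frobInner_comm_skew (A := A x) (B := B x) (hc x i)
  convert h1 using 1
  have e1 : ∀ A B C : Matrix (Fin m) (Fin m) ℝ, frobInner (A + B) C
    = frobInner A C + frobInner B C := by
    intro A B C; simp [frobInner, add_mul, Finset.sum_add_distrib]
  have e2 : ∀ A B C : Matrix (Fin m) (Fin m) ℝ, frobInner C (A + B)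
    = frobInner C A + frobInner C B := by
    intro A B C; simp [frobInner, mul_add, Finset.sum_add_distrib]
  unfold covDer
  rw [e1, e2]; linarith

lemma covDer_sum {Γ : Conn n m} {ι : Type*} {s : Finset ι}
    {A : ι → (Fin n → ℝ) → Matrix (Fin m) (Fin m) ℝ}
    (hA : ∀ k, SmoothMat (A k)) (i : Fin n) (x : Fin n → ℝ) :
    covDer Γ i (fun y => ∑ k ∈ s, A k y) x = ∑ k ∈ s, covDer Γ i (A k) x := by
  unfold covDer
  rw [pder_sum hA, Finset.sum_add_distrib]
  simp [comm, Finset.mul_sum, Finset.sum_mul]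

/-- Algebraic identity behind the monotonicity formula. -/
lemma alg_identity {V : Type*} [AddCommGroup V] [Module ℝ V] (B : V →ₗ[ℝ] V →ₗ[ℝ] ℝ)
    (hsymm : ∀ u v, B u v = B v u)
    (s : ℝ) (hs : s ≠ 0) (y : Fin n → ℝ) (F K : Fin n → Fin n → V)
    (D : Fin n → Fin n → Fin n → V) (J : Fin n → V)
    (hJ : ∀ j, J j = ∑ i, D i i j)
    (hF : ∀ i j, F i j = - F j i) (hD : ∀ k i j, D k i j = - D k j i)
    (hB : ∀ i j k, D i j k + D j k i + D k i j = 0) :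
    (∑ i, ((∑ j, 4 * (B (D i i j) (J j) + B (F i j) (K i j)))
      - (∑ j, ∑ k, (2 / s) * ((if i = k then 1 else 0) * B (F i j) (F k j)
          + y k * (B (D i i j) (F k j) + B (F i j) (D i k j))))
      + (1 / (2 * s)) * (1 * (∑ j, ∑ k, B (F j k) (F j k))
          + y i * (∑ j, ∑ k, (B (D i j k) (F j k) + B (F j k) (D i j k))))))
    - (∑ i, (y i / (2 * s)) * ((∑ j, 4 * B (F i j) (J j))
      - (∑ j, ∑ k, (2 / s) * (y k * B (F i j) (F k j)))
      + (1 / (2 * s)) * (y i * (∑ j, ∑ k, B (F j k) (F j k)))))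
    = 4 * (∑ i, ∑ j, B (F i j) (K i j))
      - (2 / s - n / (2 * s) + (∑ i, y i ^ 2) / (4 * s ^ 2)) * (∑ i, ∑ j, B (F i j) (F i j))
      + 4 * ∑ j, B (J j - (1 / (2 * s)) • ∑ k, y k • F k j)
          (J j - (1 / (2 * s)) • ∑ k, y k • F k j) := by
  have hRQ : ∀ k, ∑ i, ∑ j, B (F i j) (D i k j) = (∑ i, ∑ j, B (F i j) (D k i j)) / 2 := by
    intro k
    have h1 : ∑ i, ∑ j, B (F i j) (D i k j) = ∑ i, ∑ j, - B (F i j) (D j k i) := by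
      rw [Finset.sum_comm]
      refine Finset.sum_congr rfl fun i _ => Finset.sum_congr rfl fun j _ => ?_
      rw [hF j i]; simp
    have h2 : 2 * ∑ i, ∑ j, B (F i j) (D i k j) = ∑ i, ∑ j, B (F i j) (D k i j) := by
      rw [two_mul]; nth_rewrite 2 [h1]
      simp only [← Finset.sum_add_distrib]
      refine Finset.sum_congr rfl fun i _ => Finset.sum_congr rfl fun j _ => ?_
      have := hB i j k
      have e1 := hD i k j
      have e2 : D k i j = D i k j - D j k i := by
        rw [e1, eq_sub_iff_add_eq, eq_neg_iff_add_eq_zero, ← this]; abel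
      rw [e2, map_sub]; ring
    linarith
  set a := ∑ i, ∑ j, B (F i j) (K i j) with ha
  set S := ∑ i, ∑ j, B (F i j) (F i j) with hS
  set q := ∑ i, y i ^ 2 with hq
  let Z : Fin n → V := fun j => ∑ k, y k • F k j
  set Q := ∑ k, y k * ∑ i, ∑ j, B (F i j) (D k i j) with hQ
  have hJB : ∀ j v, B (J j) v = ∑ i, B (D i i j) v := by
    intro j v
    rw [hJ j, map_sum, LinearMap.sum_apply]
  have t1 : ∑ i, ∑ j, 4 * (B (D i i j) (J j) + B (F i j) (K i j))
      = 4 * (∑ j, B (J j) (J j)) + 4 * a := by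
    simp only [mul_add, Finset.sum_add_distrib, ← Finset.mul_sum]
    congr 2
    rw [Finset.sum_comm]
    refine Finset.sum_congr rfl fun j _ => ?_
    rw [hJB]
  have t2 : ∑ i, ∑ j, ∑ k, (2 / s) * ((if i = k then 1 else 0) * B (F i j) (F k j)
          + y k * (B (D i i j) (F k j) + B (F i j) (D i k j)))
      = (2 / s) * (S + ∑ j, B (J j) (Z j) + Q / 2) := by
    simp only [← Finset.mul_sum]
    congr 1
    simp only [mul_add, Finset.sum_add_distrib]
    rw [add_assoc]
    congr 1
    · simp [hS]
    congr 1
    · rw [Finset.sum_comm]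
      refine Finset.sum_congr rfl fun j _ => ?_
      rw [hJB]
      refine Finset.sum_congr rfl fun i _ => ?_
      simp only [Z, map_sum, map_smul, smul_eq_mul]
    · have : ∑ i, ∑ j, ∑ k, y k * B (F i j) (D i k j)
          = ∑ k, y k * ∑ i, ∑ j, B (F i j) (D i k j) := by
        simp only [Finset.mul_sum]
        rw [Finset.sum_comm_cycle]
      rw [this, hQ, Finset.sum_div]
      refine Finset.sum_congr rfl fun k _ => ?_
      rw [hRQ]; ring
  have t3 : ∑ i, (1 / (2 * s)) * (1 * S
          + y i * (∑ j, ∑ k, (B (D i j k) (F j k) + B (F j k) (D i j k))))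
      = (1 / (2 * s)) * (n * S + 2 * Q) := by
    rw [← Finset.mul_sum]
    congr 1
    rw [Finset.sum_add_distrib]
    congr 1
    · simp
    · rw [hQ, Finset.mul_sum]
      refine Finset.sum_congr rfl fun i _ => ?_
      simp only [Finset.mul_sum]
      refine Finset.sum_congr rfl fun j _ => Finset.sum_congr rfl fun k _ => ?_
      rw [hsymm (D i j k)]
      ring
  have t4 : ∑ i, (y i / (2 * s)) * ((∑ j, 4 * B (F i j) (J j))
      - (∑ j, ∑ k, (2 / s) * (y k * B (F i j) (F k j)))
      + (1 / (2 * s)) * (y i * S))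
      = (1 / (2 * s)) * (4 * (∑ j, B (J j) (Z j)) - (2 / s) * (∑ j, B (Z j) (Z j))
        + (1 / (2 * s)) * (q * S)) := by
    have : ∀ i, (y i / (2 * s)) * ((∑ j, 4 * B (F i j) (J j))
      - (∑ j, ∑ k, (2 / s) * (y k * B (F i j) (F k j)))
      + (1 / (2 * s)) * (y i * S)) = (1 / (2 * s)) * (4 * (∑ j, B (J j) (y i • F i j))
        - (2 / s) * (∑ j, B (y i • F i j) (Z j)) + (1 / (2 * s)) * (y i ^ 2 * S)) := by
      intro i
      have e1 : (∑ j, 4 * B (F i j) (J j)) = 4 * ∑ j, B (F i j) (J j) := by rw [Finset.mul_sum]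
      have e2 : (∑ j, B (J j) (y i • F i j)) = y i * ∑ j, B (F i j) (J j) := by
        rw [Finset.mul_sum]
        exact Finset.sum_congr rfl fun j _ => by rw [map_smul, smul_eq_mul, hsymm]
      have e3 : (∑ j, ∑ k, (2 / s) * (y k * B (F i j) (F k j)))
          = (2 / s) * ∑ j, B (F i j) (Z j) := by
        simp only [Z, Finset.mul_sum, map_sum, map_smul, smul_eq_mul]
      have e4 : (∑ j, B (y i • F i j) (Z j)) = y i * ∑ j, B (F i j) (Z j) := by
        rw [Finset.mul_sum]; exact Finset.sum_congr rfl fun j _ => by simp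
      rw [e1, e2, e3, e4]; ring
    simp only [this]
    rw [← Finset.mul_sum, Finset.sum_add_distrib, Finset.sum_sub_distrib, ← Finset.mul_sum,
      ← Finset.mul_sum, ← Finset.mul_sum, ← Finset.sum_mul, Finset.sum_comm]
    congr 3
    · congr 1
      refine Finset.sum_congr rfl fun j _ => ?_
      simp only [Z, map_sum]
    · congr 1
      rw [Finset.sum_comm]
      refine Finset.sum_congr rfl fun j _ => ?_
      rw [← LinearMap.sum_apply, ← map_sum]
  have t5 : ∑ j, B (J j - (1 / (2 * s)) • ∑ k, y k • F k j)
          (J j - (1 / (2 * s)) • ∑ k, y k • F k j)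
      = (∑ j, B (J j) (J j)) - (1 / s) * (∑ j, B (J j) (Z j))
        + (1 / (4 * s ^ 2)) * ∑ j, B (Z j) (Z j) := by
    rw [Finset.mul_sum, Finset.mul_sum, ← Finset.sum_sub_distrib, ← Finset.sum_add_distrib]
    refine Finset.sum_congr rfl fun j _ => ?_
    change B (J j - (1 / (2 * s)) • Z j) (J j - (1 / (2 * s)) • Z j) = _
    simp only [map_sub, LinearMap.sub_apply, map_smul, LinearMap.smul_apply, smul_eq_mul]
    rw [hsymm (Z j) (J j)]
    field_simp
    ring
  rw [Finset.sum_add_distrib, Finset.sum_sub_distrib, t1, t2, t3, t4, t5]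
  field_simp
  ring

/-- The Frobenius inner product as a bilinear form. -/
def frobB : Matrix (Fin m) (Fin m) ℝ →ₗ[ℝ] Matrix (Fin m) (Fin m) ℝ →ₗ[ℝ] ℝ :=
  LinearMap.mk₂ ℝ frobInner
    (fun A B C => by simp [frobInner, add_mul, Finset.sum_add_distrib])
    (fun c A B => by simp [frobInner, Finset.mul_sum, mul_assoc])
    (fun A B C => by simp [frobInner, mul_add, Finset.sum_add_distrib])
    (fun c A B => by simp [frobInner, Finset.mul_sum, mul_left_comm])

lemma frobB_apply (A B : Matrix (Fin m) (Fin m) ℝ) : frobB A B = frobInner A B := rfl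

lemma frobSq_eq (A : Matrix (Fin m) (Fin m) ℝ) : frobSq A = frobInner A A := by
  simp [frobSq, frobInner, pow_two]

lemma frobSq_nonneg (A : Matrix (Fin m) (Fin m) ℝ) : 0 ≤ frobSq A :=
  Finset.sum_nonneg fun _ _ => Finset.sum_nonneg fun _ _ => sq_nonneg _

lemma frobInner_symm (A B : Matrix (Fin m) (Fin m) ℝ) : frobInner A B = frobInner B A := by
  simp [frobInner, mul_comm]


/-- Sub-Gaussian growth, uniformly in time. -/
def SG (J : Set ℝ) (h : ℝ → (Fin n → ℝ) → ℝ) : Prop :=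
  ∀ ε > 0, ∃ C : ℝ, ∀ t ∈ J, ∀ x, |h t x| ≤ C * Real.exp (ε * ∑ i, x i ^ 2)

lemma SG.mono {J : Set ℝ} {h g : ℝ → (Fin n → ℝ) → ℝ} (hg : SG J g)
    (hh : ∀ t ∈ J, ∀ x, |h t x| ≤ |g t x|) : SG J h := by
  intro ε hε
  obtain ⟨C, hC⟩ := hg ε hε
  exact ⟨C, fun t ht x => (hh t ht x).trans (hC t ht x)⟩

lemma SG.add {J : Set ℝ} {h g : ℝ → (Fin n → ℝ) → ℝ} (hh : SG J h) (hg : SG J g) :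
    SG J (fun t x => h t x + g t x) := by
  intro ε hε
  obtain ⟨C, hC⟩ := hh ε hε
  obtain ⟨D, hD⟩ := hg ε hε
  refine ⟨C + D, fun t ht x => (abs_add_le _ _).trans ?_⟩
  rw [add_mul]; exact add_le_add (hC t ht x) (hD t ht x)

lemma SG.mul {J : Set ℝ} {h g : ℝ → (Fin n → ℝ) → ℝ} (hh : SG J h) (hg : SG J g) :
    SG J (fun t x => h t x * g t x) := by
  intro ε hε
  obtain ⟨C, hC⟩ := hh (ε / 2) (by positivity)
  obtain ⟨D, hD⟩ := hg (ε / 2) (by positivity)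
  refine ⟨C * D, fun t ht x => ?_⟩
  rw [abs_mul]
  have h1 := hC t ht x
  refine (mul_le_mul h1 (hD t ht x) (abs_nonneg _) ((abs_nonneg _).trans h1)).trans (le_of_eq ?_)
  have : Real.exp (ε * ∑ i, x i ^ 2) = Real.exp (ε / 2 * ∑ i, x i ^ 2)
      * Real.exp (ε / 2 * ∑ i, x i ^ 2) := by rw [← Real.exp_add]; ring_nf
  rw [this]; ring

lemma SG.of_bdd {J : Set ℝ} {h : ℝ → (Fin n → ℝ) → ℝ} (C : ℝ)
    (hh : ∀ t ∈ J, ∀ x, |h t x| ≤ C) : SG J h := by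
  intro ε hε
  refine ⟨C, fun t ht x => (hh t ht x).trans ?_⟩
  have h0 : 0 ≤ C := (abs_nonneg _).trans (hh t ht x)
  have : 1 ≤ Real.exp (ε * ∑ i, x i ^ 2) :=
    Real.one_le_exp (mul_nonneg hε.le (Finset.sum_nonneg fun i _ => sq_nonneg _))
  nlinarith

lemma SG.const {J : Set ℝ} (c : ℝ) : SG J (fun _ (_ : Fin n → ℝ) => c) :=
  SG.of_bdd |c| fun _ _ _ => le_rfl

lemma SG.neg {J : Set ℝ} {h : ℝ → (Fin n → ℝ) → ℝ} (hh : SG J h) :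
    SG J (fun t x => - h t x) := hh.mono fun t _ x => by rw [abs_neg]

lemma SG.sub {J : Set ℝ} {h g : ℝ → (Fin n → ℝ) → ℝ} (hh : SG J h) (hg : SG J g) :
    SG J (fun t x => h t x - g t x) := by
  simpa only [sub_eq_add_neg] using hh.add hg.neg

lemma SG.sum {ι : Type*} {s : Finset ι} {J : Set ℝ} {h : ι → ℝ → (Fin n → ℝ) → ℝ}
    (hh : ∀ k, SG J (h k)) : SG J (fun t x => ∑ k ∈ s, h k t x) := by
  classical
  induction s using Finset.induction_on with
  | empty => simpa using SG.const 0
  | insert a s ha ih => simp only [Finset.sum_insert ha]; exact (hh a).add ih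

lemma SG.enorm {J : Set ℝ} : SG J (fun _ (x : Fin n → ℝ) => enorm x) := by
  intro ε hε
  refine ⟨1 + 1 / ε, fun t _ x => ?_⟩
  have hq : 0 ≤ ∑ i, x i ^ 2 := Finset.sum_nonneg fun i _ => sq_nonneg _
  have h1 : YM.enorm x ^ 2 = ∑ i, x i ^ 2 := Real.sq_sqrt hq
  have h0 : 0 ≤ YM.enorm x := Real.sqrt_nonneg _
  rw [abs_of_nonneg h0, ← h1]
  have h2 := Real.add_one_le_exp (ε * YM.enorm x ^ 2)
  have h3 : (1 + 1 / ε) * (ε * YM.enorm x ^ 2 + 1) ≤ (1 + 1 / ε) * Real.exp (ε * YM.enorm x ^ 2) :=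
    mul_le_mul_of_nonneg_left h2 (by positivity)
  have h4 : (1 + 1 / ε) * (ε * YM.enorm x ^ 2 + 1)
      = ε * YM.enorm x ^ 2 + 1 + YM.enorm x ^ 2 + 1 / ε := by field_simp; ring
  have h5 : 0 ≤ ε * YM.enorm x ^ 2 := by positivity
  have h6 : 0 ≤ 1 / ε := by positivity
  nlinarith [sq_nonneg (YM.enorm x - 1)]

lemma SG.poly {J : Set ℝ} (p : Polynomial ℝ) :
    SG J (fun _ (x : Fin n → ℝ) => p.eval (YM.enorm x)) := by
  induction p using Polynomial.induction_on' with
  | add p q hp hq => simpa only [Polynomial.eval_add] using hp.add hq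
  | monomial k a =>
    simp only [Polynomial.eval_monomial]
    refine (SG.const a).mul ?_
    induction k with
    | zero => simpa using SG.const 1
    | succ k ih => simp only [pow_succ]; exact ih.mul SG.enorm

lemma SG.coord {J : Set ℝ} (i : Fin n) (c : ℝ) : SG J (fun _ (x : Fin n → ℝ) => x i - c) := by
  refine SG.sub (SG.mono SG.enorm fun t _ x => ?_) (SG.const c)
  have h0 : 0 ≤ YM.enorm x := Real.sqrt_nonneg _
  rw [abs_of_nonneg h0]
  exact Real.abs_le_sqrt (Finset.single_le_sum (f := fun i => x i ^ 2)
    (fun j _ => sq_nonneg _) (Finset.mem_univ i))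

/-- Gaussian factor. -/
def gE (x₀ : Fin n → ℝ) (s : ℝ) (x : Fin n → ℝ) : ℝ :=
  Real.exp (-(∑ i, (x i - x₀ i) ^ 2) / (4 * s))

lemma gE_pos (x₀ : Fin n → ℝ) (s : ℝ) (x : Fin n → ℝ) : 0 < gE x₀ s x := Real.exp_pos _

lemma gE_continuous (x₀ : Fin n → ℝ) (s : ℝ) : Continuous (gE x₀ s) := by
  unfold gE; fun_prop

lemma integrable_gauss {c : ℝ} (hc : 0 < c) :
    Integrable (fun x : Fin n → ℝ => Real.exp (-c * ∑ i, x i ^ 2)) := by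
  have h : ∀ x : Fin n → ℝ, Real.exp (-c * ∑ i, x i ^ 2) = ∏ i, Real.exp (-c * x i ^ 2) := by
    intro x; rw [← Real.exp_sum, Finset.mul_sum]
  simp only [h]
  exact Integrable.fintype_prod (f := fun _ (v : ℝ) => Real.exp (-c * v ^ 2))
    fun i => integrable_exp_neg_mul_sq hc

lemma SG.bound {J : Set ℝ} {h : ℝ → (Fin n → ℝ) → ℝ} (hh : SG J h) (x₀ : Fin n → ℝ)
    {s : ℝ → ℝ} {M : ℝ} (hM : 0 < M) (hs : ∀ t ∈ J, 0 < s t ∧ s t ≤ M) :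
    ∃ C : ℝ, ∀ t ∈ J, ∀ x,
      |h t x * gE x₀ (s t) x| ≤ C * Real.exp (-(1 / (16 * M)) * ∑ i, x i ^ 2) := by
  obtain ⟨C, hC⟩ := hh (1 / (16 * M)) (by positivity)
  refine ⟨C * Real.exp (1 / (4 * M) * ∑ i, x₀ i ^ 2), fun t ht x => ?_⟩
  obtain ⟨hs0, hsM⟩ := hs t ht
  have hq : 0 ≤ ∑ i, (x i - x₀ i) ^ 2 := Finset.sum_nonneg fun i _ => sq_nonneg _
  have h1 : ∑ i, x i ^ 2 ≤ 2 * (∑ i, (x i - x₀ i) ^ 2) + 2 * ∑ i, x₀ i ^ 2 := by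
    rw [Finset.mul_sum, Finset.mul_sum, ← Finset.sum_add_distrib]
    refine Finset.sum_le_sum fun i _ => ?_
    nlinarith [sq_nonneg (x i - 2 * x₀ i)]
  have h2 : -(∑ i, (x i - x₀ i) ^ 2) / (4 * s t) ≤ -(∑ i, (x i - x₀ i) ^ 2) / (4 * M) := by
    rw [neg_div, neg_div, neg_le_neg_iff]
    exact div_le_div_of_nonneg_left hq (by positivity) (by linarith)
  have h3 : -(∑ i, (x i - x₀ i) ^ 2) / (4 * M) ≤
      1 / (4 * M) * (∑ i, x₀ i ^ 2) + -(1 / (8 * M)) * ∑ i, x i ^ 2 := by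
    have : 1 / (4 * M) * (∑ i, x₀ i ^ 2) + -(1 / (8 * M)) * ∑ i, x i ^ 2
      = (2 * (∑ i, x₀ i ^ 2) - ∑ i, x i ^ 2) / (8 * M) := by field_simp; ring
    rw [this, div_le_div_iff₀ (by positivity) (by positivity)]
    nlinarith
  have h4 : gE x₀ (s t) x ≤ Real.exp (1 / (4 * M) * (∑ i, x₀ i ^ 2))
      * Real.exp (-(1 / (8 * M)) * ∑ i, x i ^ 2) := by
    rw [← Real.exp_add]; exact Real.exp_le_exp.2 (h2.trans h3)
  have h5 := hC t ht x
  rw [abs_mul, abs_of_pos (gE_pos _ _ _)]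
  refine (mul_le_mul h5 h4 (gE_pos _ _ _).le ((abs_nonneg _).trans h5)).trans (le_of_eq ?_)
  have : Real.exp (-(1 / (16 * M)) * ∑ i, x i ^ 2) = Real.exp (1 / (16 * M) * ∑ i, x i ^ 2)
      * Real.exp (-(1 / (8 * M)) * ∑ i, x i ^ 2) := by
    rw [← Real.exp_add]; congr 1; field_simp; ring
  rw [this]; ring

lemma SG.integrable {J : Set ℝ} {h : ℝ → (Fin n → ℝ) → ℝ} (hh : SG J h) (x₀ : Fin n → ℝ)
    {s : ℝ} (hs : 0 < s) {t : ℝ} (ht : t ∈ J) (hc : Continuous (h t)) :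
    Integrable (fun x => h t x * gE x₀ s x) := by
  obtain ⟨C, hC⟩ := hh.bound x₀ (s := fun _ => s) hs (fun t _ => ⟨hs, le_rfl⟩)
  refine ((integrable_gauss (n := n) (c := 1 / (16 * s)) (by positivity)).const_mul C).mono'
    (hc.mul (gE_continuous x₀ s)).aestronglyMeasurable (Eventually.of_forall fun x => ?_)
  exact hC t ht x

lemma gE_hd (x₀ : Fin n → ℝ) (s : ℝ) (i : Fin n) (x : Fin n → ℝ) :
    HD i (gE x₀ s) (-((x i - x₀ i) / (2 * s)) * gE x₀ s x) x := by
  have h : HD i (fun y => ∑ k, (y k - x₀ k) * (y k - x₀ k)) _ x :=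
    HD.sum fun k _ => (HD.coord i k (x₀ k) x).mul (HD.coord i k (x₀ k) x)
  have h1 : ∑ k, ((if i = k then 1 else 0) * (x k - x₀ k) + (x k - x₀ k) * (if i = k then 1 else 0))
      = 2 * (x i - x₀ i) := by
    simp [Finset.sum_add_distrib]; ring
  rw [h1] at h
  have h2 := (HasDerivAt.const_mul (-(1 / (4 * s))) h).exp
  have h3 : ∀ y, gE x₀ s y = Real.exp (-(1 / (4 * s)) * ∑ k, (y k - x₀ k) * (y k - x₀ k)) := by
    intro y; unfold gE; congr 1; simp only [pow_two]; ring
  unfold HD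
  simp only [h3]
  convert h2 using 1
  simp only [zero_smul, add_zero]
  rw [mul_comm]
  congr 1
  rcases eq_or_ne s 0 with rfl | hs
  · simp
  · field_simp; norm_num

/-- Integration by parts against the Gaussian. -/
lemma ibp (x₀ : Fin n → ℝ) (s : ℝ) (i : Fin n) {P P' : (Fin n → ℝ) → ℝ}
    (hP : ∀ x, HD i P (P' x) x)
    (h1 : Integrable (fun x => P' x * gE x₀ s x))
    (h2 : Integrable (fun x => ((x i - x₀ i) / (2 * s) * P x) * gE x₀ s x))
    (h3 : Integrable (fun x => P x * gE x₀ s x)) :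
    ∫ x, (P' x - (x i - x₀ i) / (2 * s) * P x) * gE x₀ s x = 0 := by
  have h2' : Integrable (fun x => P x * (-((x i - x₀ i) / (2 * s)) * gE x₀ s x)) := by
    convert h2.neg using 2 with x
    simp only [Pi.neg_apply]; ring
  have := integral_bilinear_hasLineDerivAt_right_eq_neg_left_of_integrable (μ := volume)
    (B := ContinuousLinearMap.mul ℝ ℝ) (v := Pi.single i 1)
    (f := P) (f' := P') (g := gE x₀ s) (g' := fun x => -((x i - x₀ i) / (2 * s)) * gE x₀ s x)
    h1 h2' h3 (fun x _ => hP x) (fun x _ => gE_hd x₀ s i x)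
  simp only [ContinuousLinearMap.mul_apply'] at this
  have e : ∀ x, (P' x - (x i - x₀ i) / (2 * s) * P x) * gE x₀ s x
      = P' x * gE x₀ s x + P x * (-((x i - x₀ i) / (2 * s)) * gE x₀ s x) := by
    intro x; ring
  simp only [e]
  rw [integral_add h1 h2', this]; ring


/-- The flow velocity `Jⱼ = Σᵢ ∇ᵢ F_{ij}`. -/
def jj (Γ : Conn n m) (j : Fin n) (x : Fin n → ℝ) : Matrix (Fin m) (Fin m) ℝ :=
  ∑ i, covDer Γ i (curv Γ i j) x

lemma Smooth.jj {Γ : Conn n m} (hΓ : Smooth Γ) (j : Fin n) : SmoothMat (jj Γ j) :=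
  SmoothMat.sum fun i => (hΓ.curv i j).covDer hΓ i

lemma covDer_jj {Γ : Conn n m} (hΓ : Smooth Γ) (i j : Fin n) (x : Fin n → ℝ) :
    covDer Γ i (jj Γ j) x = ∑ k, covDer Γ i (covDer Γ k (curv Γ k j)) x :=
  covDer_sum (fun k => (hΓ.curv k j).covDer hΓ k) i x

/-- Uniform sub-Gaussian growth of the curvature to order two. -/
structure Grow (Γt : ℝ → Conn n m) (J : Set ℝ) : Prop where
  f : ∀ i j a b, SG J (fun t x => curv (Γt t) i j x a b)
  d : ∀ i j k a b, SG J (fun t x => covDer (Γt t) i (curv (Γt t) j k) x a b)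
  dd : ∀ i j k l a b,
    SG J (fun t x => covDer (Γt t) i (covDer (Γt t) j (curv (Γt t) k l)) x a b)

lemma Grow.j {Γt : ℝ → Conn n m} {J : Set ℝ} (h : Grow Γt J) (j a b) :
    SG J (fun t x => jj (Γt t) j x a b) := by
  simp only [jj, Matrix.sum_apply]
  exact SG.sum fun i => h.d i i j a b

lemma Grow.dj {Γt : ℝ → Conn n m} {J : Set ℝ} (h : Grow Γt J) (hs : ∀ t ∈ J, Smooth (Γt t))
    (i j a b) : SG J (fun t x => covDer (Γt t) i (jj (Γt t) j) x a b) := by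
  have h1 : SG J (fun t x => ∑ k, covDer (Γt t) i (covDer (Γt t) k (curv (Γt t) k j)) x a b) :=
    SG.sum fun k => h.dd i k k j a b
  refine h1.mono fun t ht x => ?_
  rw [covDer_jj (hs t ht), Matrix.sum_apply]

lemma SG.inner {J : Set ℝ} {A B : ℝ → (Fin n → ℝ) → Matrix (Fin m) (Fin m) ℝ}
    (hA : ∀ a b, SG J (fun t x => A t x a b)) (hB : ∀ a b, SG J (fun t x => B t x a b)) :
    SG J (fun t x => frobInner (A t x) (B t x)) :=
  SG.sum fun a => SG.sum fun b => (hA a b).mul (hB a b)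

lemma SmoothMat.cont_inner {A B : (Fin n → ℝ) → Matrix (Fin m) (Fin m) ℝ} (hA : SmoothMat A)
    (hB : SmoothMat B) : Continuous (fun x => frobInner (A x) (B x)) :=
  continuous_finsetSum _ fun a _ => continuous_finsetSum _ fun b _ =>
    (hA a b).continuous.mul (hB a b).continuous

lemma normSqF_eq (Γ : Conn n m) (x : Fin n → ℝ) :
    normSqF Γ x = ∑ i, ∑ j, frobInner (curv Γ i j x) (curv Γ i j x) := by
  simp only [normSqF, frobSq_eq]

/-- The vector field whose weighted divergence appears in the monotonicity formula. -/
def PP (Γ : Conn n m) (x₀ : Fin n → ℝ) (s : ℝ) (i : Fin n) (x : Fin n → ℝ) : ℝ :=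
  (∑ j, 4 * frobInner (curv Γ i j x) (jj Γ j x))
    - (∑ j, ∑ k, (2 / s) * ((x k - x₀ k) * frobInner (curv Γ i j x) (curv Γ k j x)))
    + (1 / (2 * s)) * ((x i - x₀ i) * (∑ j, ∑ k, frobInner (curv Γ j k x) (curv Γ j k x)))

/-- Its `i`-th derivative. -/
def PP' (Γ : Conn n m) (x₀ : Fin n → ℝ) (s : ℝ) (i : Fin n) (x : Fin n → ℝ) : ℝ :=
  (∑ j, 4 * (frobInner (covDer Γ i (curv Γ i j) x) (jj Γ j x)
      + frobInner (curv Γ i j x) (covDer Γ i (jj Γ j) x)))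
    - (∑ j, ∑ k, (2 / s) * ((if i = k then 1 else 0) * frobInner (curv Γ i j x) (curv Γ k j x)
        + (x k - x₀ k) * (frobInner (covDer Γ i (curv Γ i j) x) (curv Γ k j x)
          + frobInner (curv Γ i j x) (covDer Γ i (curv Γ k j) x))))
    + (1 / (2 * s)) * (1 * (∑ j, ∑ k, frobInner (curv Γ j k x) (curv Γ j k x))
        + (x i - x₀ i) * (∑ j, ∑ k, (frobInner (covDer Γ i (curv Γ j k) x) (curv Γ j k x)
          + frobInner (curv Γ j k x) (covDer Γ i (curv Γ j k) x))))

/-- The integrand of the time derivative (without the Gaussian factor). -/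
def KK (Γ : Conn n m) (x₀ : Fin n → ℝ) (s : ℝ) (x : Fin n → ℝ) : ℝ :=
  4 * (∑ i, ∑ j, frobInner (curv Γ i j x) (covDer Γ i (jj Γ j) x))
    - (2 / s - n / (2 * s) + (∑ i, (x i - x₀ i) ^ 2) / (4 * s ^ 2)) * normSqF Γ x

lemma PP_hd {Γ : Conn n m} (hΓ : Smooth Γ) (hc : MetricCompat Γ) (x₀ : Fin n → ℝ) (s : ℝ)
    (i : Fin n) (x : Fin n → ℝ) : HD i (PP Γ x₀ s i) (PP' Γ x₀ s i x) x := by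
  have hcrd := HD.coord i i (x₀ i) x
  rw [if_pos rfl] at hcrd
  refine HD.add (HD.sub (HD.sum fun j _ => HD.const_mul _ ?_)
    (HD.sum fun j _ => HD.sum fun k _ => HD.const_mul _ ?_)) (HD.const_mul _ ?_)
  · exact hd_frobInner hc (hΓ.curv i j) (hΓ.jj j) i x
  · exact (HD.coord i k (x₀ k) x).mul (hd_frobInner hc (hΓ.curv i j) (hΓ.curv k j) i x)
  · exact hcrd.mul (HD.sum fun j _ => HD.sum fun k _ =>
      hd_frobInner hc (hΓ.curv j k) (hΓ.curv j k) i x)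

lemma KK_eq {Γ : Conn n m} (hΓ : Smooth Γ) (x₀ : Fin n → ℝ) {s : ℝ} (hs : s ≠ 0)
    (x : Fin n → ℝ) :
    KK Γ x₀ s x + 4 * ∑ j, frobSq (jj Γ j x - (1 / (2 * s)) • ∑ k, (x k - x₀ k) • curv Γ k j x)
      = ∑ i, (PP' Γ x₀ s i x - (x i - x₀ i) / (2 * s) * PP Γ x₀ s i x) := by
  have h := alg_identity (frobB (m := m)) frobInner_symm s hs (fun i => x i - x₀ i)
    (fun i j => curv Γ i j x) (fun i j => covDer Γ i (jj Γ j) x)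
    (fun i j k => covDer Γ i (curv Γ j k) x) (fun j => jj Γ j x) (fun j => rfl)
    (fun i j => curv_antisymm Γ i j x) (fun k i j => ?_) (fun i j k => bianchi hΓ i j k x)
  · simp only [frobB_apply] at h
    rw [Finset.sum_sub_distrib]
    simp only [KK, normSqF_eq, frobSq_eq]
    exact h.symm
  · have e : curv Γ i j = fun y => - curv Γ j i y := funext fun y => curv_antisymm Γ i j y
    have e2 : pder k (curv Γ i j) x = - pder k (curv Γ j i) x := by
      refine pder_eq_of_hd (hΓ.curv i j) fun a b => ?_
      rw [e]
      exact HasDerivAt.neg ((hΓ.curv j i).hd k a b x)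
    simp only [covDer, e2, curv_antisymm Γ i j x, comm]
    noncomm_ring

lemma continuous_PP {Γ : Conn n m} (hΓ : Smooth Γ) (x₀ : Fin n → ℝ) (s : ℝ) (i : Fin n) :
    Continuous (PP Γ x₀ s i) := by
  have h1 := fun i j => (hΓ.curv i j).cont_inner (hΓ.jj j)
  have h2 := fun i j k l => (hΓ.curv i j).cont_inner (hΓ.curv k l)
  unfold PP
  fun_prop

lemma continuous_PP' {Γ : Conn n m} (hΓ : Smooth Γ) (x₀ : Fin n → ℝ) (s : ℝ) (i : Fin n) :
    Continuous (PP' Γ x₀ s i) := by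
  have h0 := fun i j k => (hΓ.curv j k).covDer hΓ i
  have h0' := fun i j => (hΓ.jj j).covDer hΓ i
  have hx : ∀ k, Continuous fun x : Fin n → ℝ => x k - x₀ k := fun k => by fun_prop
  refine Continuous.add (Continuous.sub
    (continuous_finsetSum _ fun j _ => continuous_const.mul ?_)
    (continuous_finsetSum _ fun j _ => continuous_finsetSum _ fun k _ =>
      continuous_const.mul ?_)) (continuous_const.mul ?_)
  · exact ((h0 i i j).cont_inner (hΓ.jj j)).add ((hΓ.curv i j).cont_inner (h0' i j))
  · exact (continuous_const.mul ((hΓ.curv i j).cont_inner (hΓ.curv k j))).add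
      ((hx k).mul (((h0 i i j).cont_inner (hΓ.curv k j)).add
        ((hΓ.curv i j).cont_inner (h0 i k j))))
  · exact (continuous_const.mul (continuous_finsetSum _ fun j _ => continuous_finsetSum _ fun k _ =>
      (hΓ.curv j k).cont_inner (hΓ.curv j k))).add
      ((hx i).mul (continuous_finsetSum _ fun j _ => continuous_finsetSum _ fun k _ =>
        ((h0 i j k).cont_inner (hΓ.curv j k)).add ((hΓ.curv j k).cont_inner (h0 i j k))))

lemma continuous_normSqF {Γ : Conn n m} (hΓ : Smooth Γ) : Continuous (normSqF Γ) := by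
  have h2 := fun i j k l => (hΓ.curv i j).cont_inner (hΓ.curv k l)
  have : normSqF Γ = fun x => ∑ i, ∑ j, frobInner (curv Γ i j x) (curv Γ i j x) :=
    funext (normSqF_eq Γ)
  rw [this]; fun_prop

lemma continuous_FK {Γ : Conn n m} (hΓ : Smooth Γ) : Continuous
    (fun x => 4 * (∑ i, ∑ j, frobInner (curv Γ i j x) (covDer Γ i (jj Γ j) x))) := by
  have h0' := fun i j => (hΓ.jj j).covDer hΓ i
  have h5 := fun i j k l => (hΓ.curv i j).cont_inner (h0' k l)
  fun_prop

lemma continuous_KK {Γ : Conn n m} (hΓ : Smooth Γ) (x₀ : Fin n → ℝ) (s : ℝ) :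
    Continuous (KK Γ x₀ s) := by
  have := continuous_FK hΓ
  have := continuous_normSqF hΓ
  unfold KK
  fun_prop

lemma SG.normSqF {Γt : ℝ → Conn n m} {J : Set ℝ} (h : Grow Γt J) :
    SG J (fun t x => normSqF (Γt t) x) := by
  simp only [normSqF_eq]
  exact SG.sum fun i => SG.sum fun j => SG.inner (h.f i j) (h.f i j)

lemma SG.FK {Γt : ℝ → Conn n m} {J : Set ℝ} (h : Grow Γt J) (hs : ∀ t ∈ J, Smooth (Γt t)) :
    SG J (fun t x => 4 * (∑ i, ∑ j,
      frobInner (curv (Γt t) i j x) (covDer (Γt t) i (jj (Γt t) j) x))) :=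
  (SG.const 4).mul (SG.sum fun i => SG.sum fun j => SG.inner (h.f i j) (h.dj hs i j))

lemma SG.q {J : Set ℝ} (x₀ : Fin n → ℝ) :
    SG J (fun _ (x : Fin n → ℝ) => ∑ i, (x i - x₀ i) ^ 2) := by
  simp only [pow_two]
  exact SG.sum fun i => (SG.coord i _).mul (SG.coord i _)

lemma SG.PP {Γt : ℝ → Conn n m} {J : Set ℝ} (h : Grow Γt J)
    (x₀ : Fin n → ℝ) (s : ℝ) (i : Fin n) : SG J (fun t x => PP (Γt t) x₀ s i x) := by
  refine SG.add (SG.sub (SG.sum fun j => (SG.const _).mul ?_)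
    (SG.sum fun j => SG.sum fun k => (SG.const _).mul ?_)) ((SG.const _).mul ?_)
  · exact SG.inner (h.f i j) (h.j j)
  · exact (SG.coord k _).mul (SG.inner (h.f i j) (h.f k j))
  · exact (SG.coord i _).mul (SG.sum fun j => SG.sum fun k => SG.inner (h.f j k) (h.f j k))

lemma SG.PP' {Γt : ℝ → Conn n m} {J : Set ℝ} (h : Grow Γt J) (hs : ∀ t ∈ J, Smooth (Γt t))
    (x₀ : Fin n → ℝ) (s : ℝ) (i : Fin n) : SG J (fun t x => PP' (Γt t) x₀ s i x) := by
  refine SG.add (SG.sub (SG.sum fun j => (SG.const _).mul ?_)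
    (SG.sum fun j => SG.sum fun k => (SG.const _).mul ?_)) ((SG.const _).mul ?_)
  · exact (SG.inner (h.d i i j) (h.j j)).add (SG.inner (h.f i j) (h.dj hs i j))
  · exact ((SG.const _).mul (SG.inner (h.f i j) (h.f k j))).add ((SG.coord k _).mul
      ((SG.inner (h.d i i j) (h.f k j)).add (SG.inner (h.f i j) (h.d i k j))))
  · exact ((SG.const 1).mul (SG.sum fun j => SG.sum fun k => SG.inner (h.f j k) (h.f j k))).add
      ((SG.coord i _).mul (SG.sum fun j => SG.sum fun k =>
        (SG.inner (h.d i j k) (h.f j k)).add (SG.inner (h.f j k) (h.d i j k))))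

lemma SG.KK {Γt : ℝ → Conn n m} {J : Set ℝ} (h : Grow Γt J) (hs : ∀ t ∈ J, Smooth (Γt t))
    (x₀ : Fin n → ℝ) (s : ℝ) : SG J (fun t x => KK (Γt t) x₀ s x) := by
  refine SG.sub (SG.FK h hs) (SG.mul ?_ (SG.normSqF h))
  simp only [div_eq_mul_inv _ (4 * s ^ 2)]
  exact (SG.const _).add ((SG.q x₀).mul (SG.const _))

/-- The time derivative integrand has nonpositive integral. -/
lemma integral_KK_nonpos {Γt : ℝ → Conn n m} {J : Set ℝ} (h : Grow Γt J)
    (hsm : ∀ t ∈ J, Smooth (Γt t)) {t : ℝ} (ht : t ∈ J) (hc : MetricCompat (Γt t))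
    (x₀ : Fin n → ℝ) {s : ℝ} (hs : 0 < s) :
    ∫ x, KK (Γt t) x₀ s x * gE x₀ s x ≤ 0 := by
  have hΓ := hsm t ht
  have i1 : ∀ i, Integrable (fun x => PP' (Γt t) x₀ s i x * gE x₀ s x) := fun i =>
    (SG.PP' h hsm x₀ s i).integrable x₀ hs ht (continuous_PP' hΓ x₀ s i)
  have i3 : ∀ i, Integrable (fun x => PP (Γt t) x₀ s i x * gE x₀ s x) := fun i =>
    (SG.PP h x₀ s i).integrable x₀ hs ht (continuous_PP hΓ x₀ s i)
  have i2 : ∀ i, Integrable (fun x => ((x i - x₀ i) / (2 * s) * PP (Γt t) x₀ s i x)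
      * gE x₀ s x) := by
    intro i
    have hg : SG J (fun t x => (x i - x₀ i) / (2 * s) * PP (Γt t) x₀ s i x) := by
      simp only [div_eq_mul_inv]
      exact ((SG.coord i _).mul (SG.const _)).mul (SG.PP h x₀ s i)
    refine hg.integrable x₀ hs ht ?_
    have := continuous_PP hΓ x₀ s i
    fun_prop
  have i4 : Integrable (fun x => KK (Γt t) x₀ s x * gE x₀ s x) :=
    (SG.KK h hsm x₀ s).integrable x₀ hs ht (continuous_KK hΓ x₀ s)
  have i5 : ∀ i, Integrable (fun x => (PP' (Γt t) x₀ s i x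
      - (x i - x₀ i) / (2 * s) * PP (Γt t) x₀ s i x) * gE x₀ s x) := by
    intro i
    simp only [sub_mul]
    exact (i1 i).sub (i2 i)
  have e : ∫ x, ∑ i, (PP' (Γt t) x₀ s i x
      - (x i - x₀ i) / (2 * s) * PP (Γt t) x₀ s i x) * gE x₀ s x = 0 := by
    rw [integral_finsetSum _ fun i _ => i5 i]
    exact Finset.sum_eq_zero fun i _ => ibp x₀ s i (PP_hd hΓ hc x₀ s i) (i1 i) (i2 i) (i3 i)
  rw [← e]
  refine integral_mono i4 (integrable_finsetSum _ fun i _ => i5 i) fun x => ?_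
  simp only
  rw [← Finset.sum_mul, ← KK_eq hΓ x₀ hs.ne' x]
  refine mul_le_mul_of_nonneg_right ?_ (gE_pos _ _ _).le
  have : 0 ≤ ∑ j, frobSq (jj (Γt t) j x
      - (1 / (2 * s)) • ∑ k, (x k - x₀ k) • curv (Γt t) k j x) :=
    Finset.sum_nonneg fun _ _ => frobSq_nonneg _
  linarith


lemma smooth_slice {Γt : ℝ → Conn n m} {S : Set ℝ} (hsm : SmoothFamilyOn Γt S) {t : ℝ}
    (ht : t ∈ S) : Smooth (Γt t) := by
  intro k a b
  have h := (hsm k a b).comp (s := Set.univ) (f := fun y : Fin n → ℝ => (t, y))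
    (by fun_prop) (fun y _ => ⟨ht, Set.mem_univ _⟩)
  exact contDiffOn_univ.1 h

lemma abs_le_frobNorm (A : Matrix (Fin m) (Fin m) ℝ) (a b : Fin m) : |A a b| ≤ frobNorm A := by
  refine Real.abs_le_sqrt ?_
  refine (Finset.single_le_sum (f := fun b => A a b ^ 2) (fun j _ => sq_nonneg _)
    (Finset.mem_univ b)).trans ?_
  exact Finset.single_le_sum (f := fun a => ∑ b, A a b ^ 2)
    (fun j _ => Finset.sum_nonneg fun _ _ => sq_nonneg _) (Finset.mem_univ a)

lemma frobNorm_nonneg (A : Matrix (Fin m) (Fin m) ℝ) : 0 ≤ frobNorm A := Real.sqrt_nonneg _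

lemma frobNorm_curv_le (Γ : Conn n m) (i j : Fin n) (x : Fin n → ℝ) :
    frobNorm (curv Γ i j x) ≤ normF Γ x := by
  refine Real.sqrt_le_sqrt ?_
  refine (Finset.single_le_sum (f := fun j => frobSq (curv Γ i j x)) (fun j _ => frobSq_nonneg _)
    (Finset.mem_univ j)).trans ?_
  exact Finset.single_le_sum (f := fun i => ∑ j, frobSq (curv Γ i j x))
    (fun j _ => Finset.sum_nonneg fun _ _ => frobSq_nonneg _) (Finset.mem_univ i)

lemma grow_of_poly {Γt : ℝ → Conn n m} {S J : Set ℝ} (h : PolyCurvGrowth2On Γt S)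
    (hJ : IsCompact J) (hJS : J ⊆ S) : Grow Γt J := by
  obtain ⟨p, hp⟩ := h J hJ hJS
  have n1 : ∀ t x, 0 ≤ normF (Γt t) x := fun t x => Real.sqrt_nonneg _
  have n2 : ∀ t x, 0 ≤ ∑ i, ∑ j, ∑ k,
      frobNorm (covDer (Γt t) i (fun y => curv (Γt t) j k y) x) := fun t x =>
    Finset.sum_nonneg fun _ _ => Finset.sum_nonneg fun _ _ => Finset.sum_nonneg fun _ _ =>
      frobNorm_nonneg _
  have n3 : ∀ t x, 0 ≤ ∑ i, ∑ j, ∑ k, ∑ l, frobNorm (covDer (Γt t) i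
              (fun y => covDer (Γt t) j (fun z => curv (Γt t) k l z) y) x) := fun t x =>
    Finset.sum_nonneg fun _ _ => Finset.sum_nonneg fun _ _ => Finset.sum_nonneg fun _ _ =>
      Finset.sum_nonneg fun _ _ => frobNorm_nonneg _
  refine ⟨fun i j a b => (SG.poly p).mono fun t ht x => ?_,
    fun i j k a b => (SG.poly p).mono fun t ht x => ?_,
    fun i j k l a b => (SG.poly p).mono fun t ht x => ?_⟩
  all_goals
    refine le_trans ?_ (le_abs_self _)
    refine (abs_le_frobNorm _ a b).trans (le_trans ?_ (hp t ht x))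
    have m1 := n1 t x
    have m2 := n2 t x
    have m3 := n3 t x
  · have := frobNorm_curv_le (Γt t) i j x
    linarith
  · have h1 := Finset.single_le_sum (f := fun i => ∑ j, ∑ k,
      frobNorm (covDer (Γt t) i (curv (Γt t) j k) x)) (fun _ _ => Finset.sum_nonneg fun _ _ =>
        Finset.sum_nonneg fun _ _ => frobNorm_nonneg _) (Finset.mem_univ i)
    have h2 := Finset.single_le_sum (f := fun j => ∑ k,
      frobNorm (covDer (Γt t) i (curv (Γt t) j k) x)) (fun _ _ =>
        Finset.sum_nonneg fun _ _ => frobNorm_nonneg _) (Finset.mem_univ j)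
    have h3 := Finset.single_le_sum (f := fun k =>
      frobNorm (covDer (Γt t) i (curv (Γt t) j k) x)) (fun _ _ =>
        frobNorm_nonneg _) (Finset.mem_univ k)
    linarith
  · have h1 := Finset.single_le_sum (f := fun i => ∑ j, ∑ k, ∑ l,
      frobNorm (covDer (Γt t) i (covDer (Γt t) j (curv (Γt t) k l)) x))
        (fun _ _ => Finset.sum_nonneg fun _ _ => Finset.sum_nonneg fun _ _ =>
        Finset.sum_nonneg fun _ _ => frobNorm_nonneg _) (Finset.mem_univ i)
    have h2 := Finset.single_le_sum (f := fun j => ∑ k, ∑ l,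
      frobNorm (covDer (Γt t) i (covDer (Γt t) j (curv (Γt t) k l)) x))
        (fun _ _ => Finset.sum_nonneg fun _ _ =>
        Finset.sum_nonneg fun _ _ => frobNorm_nonneg _) (Finset.mem_univ j)
    have h3 := Finset.single_le_sum (f := fun k => ∑ l,
      frobNorm (covDer (Γt t) i (covDer (Γt t) j (curv (Γt t) k l)) x))
        (fun _ _ =>
        Finset.sum_nonneg fun _ _ => frobNorm_nonneg _) (Finset.mem_univ k)
    have h4 := Finset.single_le_sum (f := fun l =>
      frobNorm (covDer (Γt t) i (covDer (Γt t) j (curv (Γt t) k l)) x))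
        (fun _ _ => frobNorm_nonneg _) (Finset.mem_univ l)
    linarith

/-- Continuity in time of spatial derivatives. -/
lemma pder_continuousOn {Γt : ℝ → Conn n m} {T : ℝ}
    (hsm : SmoothFamilyOn Γt (Set.Ico 0 T)) (i k : Fin n) (x : Fin n → ℝ) (a b : Fin m) :
    ContinuousOn (fun t => pder i (fun y => Γt t y k) x a b) (Set.Ico 0 T) := by
  set φ : ℝ × (Fin n → ℝ) → ℝ := fun p => Γt p.1 p.2 k a b with hφ
  set U : Set (ℝ × (Fin n → ℝ)) := Set.Ico 0 T ×ˢ Set.univ with hU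
  have hu : UniqueDiffOn ℝ U := (uniqueDiffOn_Ico 0 T).prod uniqueDiffOn_univ
  have h1 : ContinuousOn (fderivWithin ℝ φ U) U :=
    (hsm k a b).continuousOn_fderivWithin hu (by simp)
  have h2 : ContinuousOn (fun t : ℝ => fderivWithin ℝ φ U (t, x) (0, Pi.single i 1))
      (Set.Ico 0 T) := by
    refine ContinuousOn.clm_apply ?_ continuousOn_const
    exact h1.comp (by fun_prop) (fun t ht => ⟨ht, Set.mem_univ _⟩)
  refine h2.congr fun t ht => ?_
  have hd : HasFDerivWithinAt φ (fderivWithin ℝ φ U (t, x)) U (t, x) :=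
    ((hsm k a b).differentiableOn (by simp) (t, x) ⟨ht, Set.mem_univ _⟩).hasFDerivWithinAt
  have hl : HasFDerivAt (fun y : Fin n → ℝ => (t, y))
      (ContinuousLinearMap.inr ℝ ℝ (Fin n → ℝ)) x := hasFDerivAt_prodMk_right t x
  have hc := hd.comp (s := Set.univ) x (hl.hasFDerivWithinAt)
    (fun y _ => ⟨ht, Set.mem_univ _⟩)
  rw [hasFDerivWithinAt_univ] at hc
  have := hc.fderiv
  change fderiv ℝ (φ ∘ fun y => (t, y)) x (Pi.single i 1) = _
  rw [this]; simp

lemma two_le_top : (2 : WithTop ℕ∞) ≤ ((⊤ : ℕ∞) : WithTop ℕ∞) := WithTop.coe_le_coe.2 (le_top : (2 : ℕ∞) ≤ ⊤)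
lemma mixed_aux {V : Type*} [NormedAddCommGroup V] [NormedSpace ℝ V] (φ : V → ℝ) {p : V}
    (h : ContDiffAt ℝ (⊤ : ℕ∞) φ p) : DifferentiableAt ℝ (fderiv ℝ φ) p := by
  have h2 : ContDiffAt ℝ 2 φ p := h.of_le two_le_top
  exact (h2.fderiv_right (m := 1) (by norm_num)).differentiableAt (by simp)
lemma mixed_aux2 {V : Type*} [NormedAddCommGroup V] [NormedSpace ℝ V] (φ : V → ℝ) {p : V}
    (h : ContDiffAt ℝ (⊤ : ℕ∞) φ p) : IsSymmSndFDerivAt ℝ φ p := by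
  have h2 : ContDiffAt ℝ 2 φ p := h.of_le two_le_top
  exact h2.isSymmSndFDerivAt (by simp)
lemma mixed_aux3 {V W : Type*} [NormedAddCommGroup V] [NormedSpace ℝ V] [NormedAddCommGroup W]
    [NormedSpace ℝ W] {D : V → V →L[ℝ] ℝ} {g : W → V} {L : W →L[ℝ] V} {x : W}
    {D' : V →L[ℝ] V →L[ℝ] ℝ}
    (hD : HasFDerivAt D D' (g x)) (hg : HasFDerivAt g L x) (w : V) :
    HasFDerivAt (fun y => D (g y) w) ((D'.comp L).flip w) x := by
  have h1 : HasFDerivAt (fun y => D (g y)) (D'.comp L) x := hD.comp x hg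
  exact (h1.clm_apply (hasFDerivAt_const w x)).congr_fderiv (by ext; simp)
lemma mixed_aux4 {V : Type*} [NormedAddCommGroup V] [NormedSpace ℝ V]
    {D : V → V →L[ℝ] ℝ} {g : ℝ → V} {u : V} {t : ℝ}
    {D' : V →L[ℝ] V →L[ℝ] ℝ}
    (hD : HasFDerivAt D D' (g t)) (hg : HasDerivAt g u t) (w : V) :
    HasDerivAt (fun y => D (g y) w) (D' u w) t := by
  have := (mixed_aux3 hD hg.hasFDerivAt w).hasDerivAt
  exact this.congr_deriv (by simp)
lemma mixed_hasDerivAt {V : Type*} [NormedAddCommGroup V] [NormedSpace ℝ V] (φ : ℝ × V → ℝ) {t : ℝ} {x : V} (v : V)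
    (h : ContDiffAt ℝ (⊤ : ℕ∞) φ (t, x)) :
    HasDerivAt (fun t' => fderiv ℝ φ (t', x) (0, v))
      (fderiv ℝ (fun y => fderiv ℝ φ (t, y) (1, 0)) x v) t := by
  have hD := (mixed_aux φ h).hasFDerivAt
  have hsymm := mixed_aux2 φ h
  have h2 : HasDerivAt (fun t' => (t', x)) ((1 : ℝ), (0 : V)) t :=
    (hasDerivAt_id t).prodMk (hasDerivAt_const t x)
  refine (mixed_aux4 (g := fun t' => (t', x)) hD h2 (0, v)).congr_deriv ?_
  have e := (mixed_aux3 (g := fun y => (t, y)) hD (hasFDerivAt_prodMk_right t x) (1, 0)).fderiv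
  rw [e]
  exact hsymm (1, 0) (0, v)

/-- Time derivative of spatial derivatives. -/
lemma pder_hasDerivAt {Γt : ℝ → Conn n m} {T : ℝ}
    (hsm : SmoothFamilyOn Γt (Set.Ico 0 T)) (hflow : YMFlowOn Γt (Set.Ico 0 T))
    (i k : Fin n) (x : Fin n → ℝ) (a b : Fin m) {t : ℝ} (ht : t ∈ Set.Ioo 0 T) :
    HasDerivAt (fun t => pder i (fun y => Γt t y k) x a b) (pder i (jj (Γt t) k) x a b) t := by
  obtain ⟨φ, hφ⟩ : ∃ φ : ℝ × (Fin n → ℝ) → ℝ, φ = fun p => Γt p.1 p.2 k a b := ⟨_, rfl⟩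
  have hφs : ∀ t ∈ Set.Ioo 0 T, ∀ y, ContDiffAt ℝ (⊤ : ℕ∞) φ (t, y) := by
    intro t ht y
    rw [hφ]
    refine (hsm k a b).contDiffAt ?_
    exact prod_mem_nhds (Ico_mem_nhds ht.1 ht.2) univ_mem
  have hφd : ∀ t ∈ Set.Ioo 0 T, ∀ y, HasFDerivAt φ (fderiv ℝ φ (t, y)) (t, y) :=
    fun t ht y => ((hφs t ht y).differentiableAt (by simp)).hasFDerivAt
  have hx : ∀ t ∈ Set.Ioo 0 T, pder i (fun y => Γt t y k) x a b
      = fderiv ℝ φ (t, x) (0, Pi.single i 1) := by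
    intro t ht
    have hc := (hφd t ht x).comp x (hasFDerivAt_prodMk_right t x)
    have h1 : pder i (fun y => Γt t y k) x a b
        = fderiv ℝ (φ ∘ fun y => (t, y)) x (Pi.single i 1) := by rw [hφ]; rfl
    rw [h1, hc.fderiv]; simp
  have htt : ∀ y, jj (Γt t) k y a b = fderiv ℝ φ (t, y) (1, 0) := by
    intro y
    have h1 := (hflow t ⟨ht.1.le, ht.2⟩ y k a b).hasDerivAt (Ico_mem_nhds ht.1 ht.2)
    have h2 : HasDerivAt (fun t' => (t', y)) ((1 : ℝ), (0 : Fin n → ℝ)) t :=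
      (hasDerivAt_id t).prodMk (hasDerivAt_const t y)
    have h3 := (hφd t ht y).comp_hasDerivAt t h2
    have h4 : (φ ∘ fun t' => (t', y)) = fun t' => Γt t' y k a b := by rw [hφ]; rfl
    rw [h4] at h3
    exact h1.unique h3
  have e : pder i (jj (Γt t) k) x a b
      = fderiv ℝ (fun y => fderiv ℝ φ (t, y) (1, 0)) x (Pi.single i 1) := by
    have h5 : (fun y => fderiv ℝ φ (t, y) (1, 0)) = fun y => jj (Γt t) k y a b :=
      funext fun y => (htt y).symm
    rw [h5]; rfl
  rw [e]
  refine (mixed_hasDerivAt φ (Pi.single i 1) (hφs t ht x)).congr_of_eventuallyEq ?_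
  filter_upwards [Ioo_mem_nhds ht.1 ht.2] with t' ht'
  exact hx t' ht'

lemma curv_continuousOn {Γt : ℝ → Conn n m} {T : ℝ}
    (hsm : SmoothFamilyOn Γt (Set.Ico 0 T)) (i j : Fin n) (x : Fin n → ℝ) (a b : Fin m) :
    ContinuousOn (fun t => curv (Γt t) i j x a b) (Set.Ico 0 T) := by
  have hc : ∀ k a b, ContinuousOn (fun t => Γt t x k a b) (Set.Ico 0 T) := fun k a b =>
    (hsm k a b).continuousOn.comp (f := fun t => (t, x)) (by fun_prop)
      (fun t ht => ⟨ht, Set.mem_univ _⟩)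
  refine ((pder_continuousOn hsm i j x a b).sub (pder_continuousOn hsm j i x a b)).add ?_
  simp only [comm, Matrix.sub_apply, Matrix.mul_apply]
  exact (continuousOn_finsetSum _ fun c _ => (hc i a c).mul (hc j c b)).sub
    (continuousOn_finsetSum _ fun c _ => (hc j a c).mul (hc i c b))

lemma curv_hasDerivAt {Γt : ℝ → Conn n m} {T : ℝ}
    (hsm : SmoothFamilyOn Γt (Set.Ico 0 T)) (hflow : YMFlowOn Γt (Set.Ico 0 T))
    (i j : Fin n) (x : Fin n → ℝ) (a b : Fin m) {t : ℝ} (ht : t ∈ Set.Ioo 0 T) :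
    HasDerivAt (fun t => curv (Γt t) i j x a b)
      ((covDer (Γt t) i (jj (Γt t) j) x - covDer (Γt t) j (jj (Γt t) i) x) a b) t := by
  have hc : ∀ k a b, HasDerivAt (fun t => Γt t x k a b) (jj (Γt t) k x a b) t := fun k a b =>
    (hflow t ⟨ht.1.le, ht.2⟩ x k a b).hasDerivAt (Ico_mem_nhds ht.1 ht.2)
  have hm : ∀ i j, HasDerivAt (fun t => (Γt t x i * Γt t x j) a b)
      ((jj (Γt t) i x * Γt t x j + Γt t x i * jj (Γt t) j x) a b) t := by
    intro i j
    simp only [Matrix.add_apply, Matrix.mul_apply, ← Finset.sum_add_distrib]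
    exact HasDerivAt.fun_sum fun c _ => (hc i a c).mul (hc j c b)
  have h := ((pder_hasDerivAt hsm hflow i j x a b ht).sub
    (pder_hasDerivAt hsm hflow j i x a b ht)).add ((hm i j).sub (hm j i))
  refine h.congr_deriv ?_
  simp only [covDer, comm, Matrix.sub_apply, Matrix.add_apply]
  ring

lemma normSqF_continuousOn {Γt : ℝ → Conn n m} {T : ℝ}
    (hsm : SmoothFamilyOn Γt (Set.Ico 0 T)) (x : Fin n → ℝ) :
    ContinuousOn (fun t => normSqF (Γt t) x) (Set.Ico 0 T) :=
  continuousOn_finsetSum _ fun i _ => continuousOn_finsetSum _ fun j _ =>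
    continuousOn_finsetSum _ fun a _ => continuousOn_finsetSum _ fun b _ =>
      (curv_continuousOn hsm i j x a b).pow 2

lemma normSqF_hasDerivAt {Γt : ℝ → Conn n m} {T : ℝ}
    (hsm : SmoothFamilyOn Γt (Set.Ico 0 T)) (hflow : YMFlowOn Γt (Set.Ico 0 T))
    (x : Fin n → ℝ) {t : ℝ} (ht : t ∈ Set.Ioo 0 T) :
    HasDerivAt (fun t => normSqF (Γt t) x) (4 * (∑ i, ∑ j,
      frobInner (curv (Γt t) i j x) (covDer (Γt t) i (jj (Γt t) j) x))) t := by
  have h : HasDerivAt (fun t => normSqF (Γt t) x) (∑ i, ∑ j, 2 * frobInner (curv (Γt t) i j x)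
      (covDer (Γt t) i (jj (Γt t) j) x - covDer (Γt t) j (jj (Γt t) i) x)) t := by
    refine HasDerivAt.fun_sum fun i _ => HasDerivAt.fun_sum fun j _ => ?_
    simp only [frobInner, frobSq, Finset.mul_sum]
    refine HasDerivAt.fun_sum fun a _ => HasDerivAt.fun_sum fun b _ => ?_
    refine ((curv_hasDerivAt hsm hflow i j x a b ht).pow 2).congr_deriv ?_
    simp; ring
  refine h.congr_deriv ?_
  simp only [← frobB_apply, map_sub, mul_sub, Finset.sum_sub_distrib]
  have e : ∑ i, ∑ j, 2 * frobB (curv (Γt t) i j x) (covDer (Γt t) j (jj (Γt t) i) x)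
      = - ∑ i, ∑ j, 2 * frobB (curv (Γt t) i j x) (covDer (Γt t) i (jj (Γt t) j) x) := by
    rw [Finset.sum_comm]
    simp only [← Finset.sum_neg_distrib]
    refine Finset.sum_congr rfl fun i _ => Finset.sum_congr rfl fun j _ => ?_
    rw [curv_antisymm (Γt t) j i]; simp
  rw [e]
  simp only [← Finset.mul_sum]
  ring


/-- Time derivative of the backward Gaussian. -/
lemma gE_hasDerivAt (x₀ x : Fin n → ℝ) (c : ℝ) {t : ℝ} (h : 0 < c - t) :
    HasDerivAt (fun t => gE x₀ (c - t) x)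
      (-((∑ i, (x i - x₀ i) ^ 2) / (4 * (c - t) ^ 2)) * gE x₀ (c - t) x) t := by
  have h1 : HasDerivAt (fun t : ℝ => 4 * (c - t)) (4 * -1) t :=
    ((hasDerivAt_id t).const_sub c).const_mul 4
  have h2 := ((hasDerivAt_const t (-(∑ i, (x i - x₀ i) ^ 2))).div h1 (by positivity)).exp
  refine h2.congr_deriv ?_
  unfold gE
  rw [mul_comm]
  congr 1
  field_simp
  ring

/-- The time derivative of the prefactor. -/
lemma pref_hasDerivAt (c : ℝ) {t : ℝ} (h : 0 < c - t) :
    HasDerivAt (fun t => (c - t) ^ 2 * (4 * π * (c - t)) ^ (-(n : ℝ) / 2))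
      (-((c - t) ^ 2 * (4 * π * (c - t)) ^ (-(n : ℝ) / 2)) * (2 / (c - t) - n / (2 * (c - t)))) t := by
  have hp : 0 < 4 * π * (c - t) := by positivity
  have h0 : HasDerivAt (fun t : ℝ => c - t) (-1) t := (hasDerivAt_id t).const_sub c
  have h1 := (h0.pow 2).mul ((h0.const_mul (4 * π)).rpow_const (p := -(n : ℝ) / 2) (Or.inl hp.ne'))
  refine h1.congr_deriv ?_
  rw [Real.rpow_sub_one hp.ne']
  have hpi := Real.pi_pos
  simp only [Pi.pow_apply]
  field_simp
  ring

lemma SG_deriv {Γt : ℝ → Conn n m} {J : Set ℝ} (h : Grow Γt J) (hs : ∀ t ∈ J, Smooth (Γt t))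
    (x₀ : Fin n → ℝ) {c δ : ℝ} (hδ : 0 < δ) (hc : ∀ t ∈ J, δ ≤ c - t) :
    SG J (fun t x => 4 * (∑ i, ∑ j,
      frobInner (curv (Γt t) i j x) (covDer (Γt t) i (jj (Γt t) j) x))
      - (∑ i, (x i - x₀ i) ^ 2) / (4 * (c - t) ^ 2) * normSqF (Γt t) x) := by
  refine SG.sub (SG.FK h hs) (SG.mul ?_ (SG.normSqF h))
  have hb : SG J (fun t (_ : Fin n → ℝ) => (4 * (c - t) ^ 2)⁻¹) := by
    refine SG.of_bdd ((4 * δ ^ 2)⁻¹) fun t ht x => ?_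
    have := hc t ht
    rw [abs_of_nonneg (by positivity)]
    gcongr
  exact (SG.q x₀).mul hb

lemma Ffunc_mono {Γt : ℝ → Conn n m} {T : ℝ}
    (hsm : SmoothFamilyOn Γt (Set.Ico 0 T))
    (hmc : ∀ t ∈ Set.Ico (0:ℝ) T, MetricCompat (Γt t))
    (hflow : YMFlowOn Γt (Set.Ico 0 T))
    (hpoly : PolyCurvGrowth2On Γt (Set.Ico 0 T))
    {t₁ t₂ : ℝ} (h0 : 0 ≤ t₁) (h12 : t₁ ≤ t₂) (h2 : t₂ < T) (x₀ : Fin n → ℝ) {t₀ : ℝ}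
    (ht₀ : 0 < t₀) : Ffunc (Γt t₂) x₀ t₀ ≤ Ffunc (Γt t₁) x₀ (t₀ + t₂ - t₁) := by
  have hJ : Set.Icc t₁ t₂ ⊆ Set.Ico 0 T := fun t ht => ⟨h0.trans ht.1, ht.2.trans_lt h2⟩
  have hG : Grow Γt (Set.Icc t₁ t₂) := grow_of_poly hpoly isCompact_Icc hJ
  have hS : ∀ t ∈ Set.Icc t₁ t₂, Smooth (Γt t) := fun t ht => smooth_slice hsm (hJ ht)
  obtain ⟨c, hc⟩ : ∃ c, c = t₀ + t₂ := ⟨_, rfl⟩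
  have hM : 0 < c - t₁ := by linarith
  have hδ : ∀ t ∈ Set.Icc t₁ t₂, t₀ ≤ c - t := fun t ht => by linarith [ht.2]
  have hs : ∀ t ∈ Set.Icc t₁ t₂, 0 < c - t ∧ c - t ≤ c - t₁ := fun t ht =>
    ⟨by linarith [ht.2], by linarith [ht.1]⟩
  have hgint : ∀ C : ℝ, Integrable
      (fun x : Fin n → ℝ => C * Real.exp (-(1 / (16 * (c - t₁))) * ∑ i, x i ^ 2)) := fun C =>
    (integrable_gauss (by positivity)).const_mul C
  have hmeas : ∀ t ∈ Set.Icc t₁ t₂, AEStronglyMeasurable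
      (fun x => normSqF (Γt t) x * gE x₀ (c - t) x) volume := fun t ht =>
    ((continuous_normSqF (hS t ht)).mul (gE_continuous _ _)).aestronglyMeasurable
  have hI : ContinuousOn (fun t => ∫ x, normSqF (Γt t) x * gE x₀ (c - t) x)
      (Set.Icc t₁ t₂) := by
    obtain ⟨C, hC⟩ := (SG.normSqF hG).bound x₀ (s := fun t => c - t) hM hs
    refine continuousOn_of_dominated hmeas (fun t ht => Eventually.of_forall fun x => hC t ht x)
      (hgint C) (Eventually.of_forall fun x => ?_)
    refine ((normSqF_continuousOn hsm x).mono hJ).mul fun t ht => ?_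
    exact (gE_hasDerivAt x₀ x c (hs t ht).1).continuousAt.continuousWithinAt
  have hI' : ∀ t ∈ Set.Ioo t₁ t₂, HasDerivAt (fun t => ∫ x, normSqF (Γt t) x * gE x₀ (c - t) x)
      (∫ x, (4 * (∑ i, ∑ j,
      frobInner (curv (Γt t) i j x) (covDer (Γt t) i (jj (Γt t) j) x))
      - (∑ i, (x i - x₀ i) ^ 2) / (4 * (c - t) ^ 2) * normSqF (Γt t) x) * gE x₀ (c - t) x) t := by
    intro t ht
    have htI := Set.Ioo_subset_Icc_self ht
    obtain ⟨C, hC⟩ := (SG_deriv hG hS x₀ ht₀ hδ).bound x₀ (s := fun t => c - t) hM hs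
    have hq : Continuous fun x : Fin n → ℝ => (∑ i, (x i - x₀ i) ^ 2) / (4 * (c - t) ^ 2) := by
      fun_prop
    refine (hasDerivAt_integral_of_dominated_loc_of_deriv_le
      (F := fun t x => normSqF (Γt t) x * gE x₀ (c - t) x)
      (F' := fun t x => (4 * (∑ i, ∑ j,
        frobInner (curv (Γt t) i j x) (covDer (Γt t) i (jj (Γt t) j) x))
        - (∑ i, (x i - x₀ i) ^ 2) / (4 * (c - t) ^ 2) * normSqF (Γt t) x) * gE x₀ (c - t) x)
      (s := Set.Ioo t₁ t₂) (Ioo_mem_nhds ht.1 ht.2) ?_ ?_ ?_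
      (Eventually.of_forall fun x t ht => hC t (Set.Ioo_subset_Icc_self ht) x) (hgint C)
      (Eventually.of_forall fun x t ht => ?_)).2
    · filter_upwards [Ioo_mem_nhds ht.1 ht.2] with t ht
      exact hmeas t (Set.Ioo_subset_Icc_self ht)
    · exact (SG.normSqF hG).integrable x₀ (hs t htI).1 htI (continuous_normSqF (hS t htI))
    · exact (((continuous_FK (hS t htI)).sub (hq.mul (continuous_normSqF (hS t htI)))).mul
        (gE_continuous _ _)).aestronglyMeasurable
    · have hts := hs t (Set.Ioo_subset_Icc_self ht)
      have hd := (normSqF_hasDerivAt hsm hflow x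
        (t := t) ⟨h0.trans_lt ht.1, ht.2.trans h2⟩).mul (gE_hasDerivAt x₀ x c hts.1)
      exact hd.congr_deriv (by ring)
  have hanti : AntitoneOn (fun t => (c - t) ^ 2 * (4 * π * (c - t)) ^ (-(n : ℝ) / 2) *
      ∫ x, normSqF (Γt t) x * gE x₀ (c - t) x) (Set.Icc t₁ t₂) := by
    have hder : ∀ t ∈ Set.Ioo t₁ t₂, HasDerivAt (fun t => (c - t) ^ 2 *
        (4 * π * (c - t)) ^ (-(n : ℝ) / 2) * ∫ x, normSqF (Γt t) x * gE x₀ (c - t) x)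
        ((c - t) ^ 2 * (4 * π * (c - t)) ^ (-(n : ℝ) / 2) *
          ∫ x, KK (Γt t) x₀ (c - t) x * gE x₀ (c - t) x) t := by
      intro t ht
      have htI := Set.Ioo_subset_Icc_self ht
      refine ((pref_hasDerivAt (n := n) c (hs t htI).1).mul (hI' t ht)).congr_deriv ?_
      have hi1 := (SG_deriv hG hS x₀ ht₀ hδ).integrable x₀ (hs t htI).1 htI (by
        have hq : Continuous fun x : Fin n → ℝ =>
          (∑ i, (x i - x₀ i) ^ 2) / (4 * (c - t) ^ 2) := by fun_prop
        exact (continuous_FK (hS t htI)).sub (hq.mul (continuous_normSqF (hS t htI))))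
      have hi2 := (SG.normSqF hG).integrable x₀ (hs t htI).1 htI (continuous_normSqF (hS t htI))
      have e : ∫ x, KK (Γt t) x₀ (c - t) x * gE x₀ (c - t) x
          = (∫ x, (4 * (∑ i, ∑ j,
            frobInner (curv (Γt t) i j x) (covDer (Γt t) i (jj (Γt t) j) x))
            - (∑ i, (x i - x₀ i) ^ 2) / (4 * (c - t) ^ 2) * normSqF (Γt t) x) * gE x₀ (c - t) x)
            - (2 / (c - t) - n / (2 * (c - t))) *
              ∫ x, normSqF (Γt t) x * gE x₀ (c - t) x := by
        rw [← integral_const_mul, ← integral_sub hi1 (hi2.const_mul _)]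
        congr 1
        ext x
        unfold KK
        ring
      rw [e]
      ring
    refine antitoneOn_of_deriv_nonpos (convex_Icc _ _) ?_ ?_ ?_
    · refine ContinuousOn.mul (fun t ht => ?_) hI
      exact (pref_hasDerivAt (n := n) c (hs t ht).1).continuousAt.continuousWithinAt
    · rw [interior_Icc]
      exact fun t ht => (hder t ht).differentiableAt.differentiableWithinAt
    · rw [interior_Icc]
      intro t ht
      have htI := Set.Ioo_subset_Icc_self ht
      rw [(hder t ht).deriv]
      have hp := (hs t htI).1
      exact mul_nonpos_of_nonneg_of_nonpos (by positivity)
        (integral_KK_nonpos hG hS htI (hmc t (hJ htI)) x₀ hp)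
  have hfin := hanti (Set.left_mem_Icc.2 h12) (Set.right_mem_Icc.2 h12) h12
  have e2 : c - t₂ = t₀ := by linarith
  simp only [e2] at hfin
  rw [hc] at hfin
  exact hfin

end YM

/-- **Entropy monotonicity along Yang–Mills flow**
(Proposition `solitonmonotonicity`). -/
theorem entropy_monotone (n m : ℕ) (T : ℝ) (hT : 0 < T)
    (Γt : ℝ → YM.Conn n m)
    (hsm : YM.SmoothFamilyOn Γt (Set.Ico 0 T))
    (hmc : ∀ t ∈ Set.Ico (0:ℝ) T, YM.MetricCompat (Γt t))
    (hflow : YM.YMFlowOn Γt (Set.Ico 0 T))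
    (hpoly : YM.PolyCurvGrowth2On Γt (Set.Ico 0 T))
    (t₁ t₂ : ℝ) (h0 : 0 ≤ t₁) (h12 : t₁ ≤ t₂) (h2 : t₂ < T) :
    YM.entropy (Γt t₂) ≤ YM.entropy (Γt t₁) := by
  refine iSup_le fun x₀ => iSup_le fun t₀ => iSup_le fun ht₀ => ?_
  have h := YM.Ffunc_mono hsm hmc hflow hpoly h0 h12 h2 x₀ ht₀
  have hp : 0 < t₀ + t₂ - t₁ := by linarith
  refine (ENNReal.ofReal_le_ofReal h).trans ?_
  unfold YM.entropy
  exact le_iSup_of_le x₀ (le_iSup_of_le (t₀ + t₂ - t₁) (le_iSup_of_le hp le_rfl))
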